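/- Let n ≥ 1 and 0 < r < 1. There is no Hamiltonian isotopy of E = ℝⁿ × ℝⁿ sending the closed unit ball into the cylinder of radius r. Precisely: there do not exist an open interval I containing 0 and 1, a C^∞ map Φ : E × I → E and a C^∞ function h : E × I → ℝ such that Φ(·,0) = id_E, ∂Φ/∂s(p,s) = X_{h(·,s)}(Φ(p,s)) for all (p,s) ∈ E × I, and Φ(·,1)(B̄₁) ⊆ { (x,ξ) ∈ E : x₁² + ξ₁² ≤ r² }, where B̄₁ = { (x,ξ) ∈ E : ‖x‖² + ‖ξ‖² ≤ 1 } is the closed unit ball. (Gromov nonsqueezing theorem for Hamiltonian isotopies.) -/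

import Mathlib

open scoped RealInnerProductSpace ContDiff

noncomputable section

/-- `E = ℝⁿ × ℝⁿ`. -/
abbrev Esp (n : ℕ) : Type := EuclideanSpace ℝ (Fin n) × EuclideanSpace ℝ (Fin n)

/-- The Hamiltonian vector field `X_h(x,ξ) = (∇_ξ h(x,ξ), −∇_x h(x,ξ))` of a function
`h : E → ℝ`. -/
def hamVF {n : ℕ} (h : Esp n → ℝ) (p : Esp n) : Esp n :=
  (gradient (fun η => h (p.1, η)) p.2, - gradient (fun y => h (y, p.2)) p.1)

section Brouwer
open MeasureTheory Metric Set Polynomial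

variable {V : Type*} [NormedAddCommGroup V] [InnerProductSpace ℝ V] [FiniteDimensional ℝ V]

/-- `t ↦ det (1 + t A)` is a polynomial of degree at most `dim V`, hence is determined by
Lagrange interpolation from its values at `dim V + 1` nodes. -/
lemma det_one_add_eq_sum_lagrange (v : ℕ → ℝ) (hv : Function.Injective v) (A : V →L[ℝ] V) :
    ((1 : V →L[ℝ] V) + A).det = ∑ i ∈ Finset.range (Module.finrank ℝ V + 1),
      ((1 : V →L[ℝ] V) + v i • A).det *
        (Lagrange.basis (Finset.range (Module.finrank ℝ V + 1)) v i).eval 1 := by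
  classical
  let b := Module.finBasis ℝ V
  let M := LinearMap.toMatrix b b (A : V →ₗ[ℝ] V)
  let p : ℝ[X] := ((X : ℝ[X]) • M.map C + (1 : Matrix _ _ ℝ).map C).det
  have hp : ∀ t : ℝ, p.eval t = ((1 : V →L[ℝ] V) + t • A).det := by
    intro t
    have h1 : ((1 : V →L[ℝ] V) + t • A).det
        = (LinearMap.toMatrix b b (((1 : V →L[ℝ] V) + t • A : V →L[ℝ] V) : V →ₗ[ℝ] V)).det := by
      rw [LinearMap.det_toMatrix]
    have h2 : LinearMap.toMatrix b b (((1 : V →L[ℝ] V) + t • A : V →L[ℝ] V) : V →ₗ[ℝ] V)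
        = t • M + 1 := by
      have : (((1 : V →L[ℝ] V) + t • A : V →L[ℝ] V) : V →ₗ[ℝ] V)
          = LinearMap.id + t • (A : V →ₗ[ℝ] V) := rfl
      rw [this, map_add, LinearMap.toMatrix_id, map_smul, add_comm]
    rw [h1, h2]
    have h3 := RingHom.map_det (Polynomial.evalRingHom t)
      ((X : ℝ[X]) • M.map C + (1 : Matrix _ _ ℝ).map C)
    rw [Polynomial.coe_evalRingHom] at h3
    change eval t (Matrix.det _) = _
    rw [h3]
    congr 1
    ext i j
    by_cases hij : i = j <;> simp [hij, mul_comm t]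
  have hdeg : p.degree < (Finset.range (Module.finrank ℝ V + 1)).card := by
    have h := Polynomial.natDegree_det_X_add_C_le M (1 : Matrix _ _ ℝ)
    rw [Finset.card_range]
    refine lt_of_le_of_lt Polynomial.degree_le_natDegree ?_
    simp only [Fintype.card_fin] at h
    exact_mod_cast Nat.lt_succ_of_le h
  have hL := Lagrange.eq_interpolate_of_eval_eq (v := v)
    (fun i => ((1 : V →L[ℝ] V) + v i • A).det) (hv.injOn) hdeg (fun i _ => hp (v i))
  have h1 := hp 1
  rw [one_smul] at h1
  rw [← h1, hL, Lagrange.interpolate_apply, Polynomial.eval_finsetSum]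
  simp

lemma not_retraction_of_lipschitz {ρ : ℝ} (hρ : 0 < ρ) {g : V → V} {K : NNReal}
    (hK : LipschitzWith K g) (h0 : ∀ x, ρ ≤ ‖x‖ → g x = 0) (hg : ContDiffOn ℝ 1 g (ball 0 ρ))
    (hr : ∀ x, ‖x‖ < ρ → ‖x + g x‖ = ρ) : False := by
  borelize V
  let μ : Measure V := Measure.addHaar
  set B : Set V := ball 0 ρ with hB
  have hBo : IsOpen B := isOpen_ball
  have hdiff : ∀ x ∈ B, HasFDerivAt g (fderiv ℝ g x) x := fun x hx =>
    ((hg.contDiffAt (hBo.mem_nhds hx)).differentiableAt one_ne_zero).hasFDerivAt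
  have hcont : ContinuousOn (fun x => fderiv ℝ g x) B :=
    hg.continuousOn_fderiv_of_isOpen hBo le_rfl
  have hbd : ∀ x, ‖fderiv ℝ g x‖ ≤ K := fun x => norm_fderiv_le_of_lipschitz ℝ hK
  have hdetc : ∀ t : ℝ, ContinuousOn (fun x => ((1 : V →L[ℝ] V) + t • fderiv ℝ g x).det) B :=
    fun t => ContinuousLinearMap.continuous_det.comp_continuousOn
      (continuousOn_const.add (hcont.const_smul t))
  have hμB : μ B ≠ ⊤ := measure_ball_lt_top.ne
  have hint : ∀ t : ℝ, IntegrableOn (fun x => ((1 : V →L[ℝ] V) + t • fderiv ℝ g x).det) B μ := by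
    intro t
    have hcpt : IsCompact (closedBall (0 : V →L[ℝ] V) (K : ℝ)) := isCompact_closedBall _ _
    have hc : Continuous (fun A : V →L[ℝ] V => ((1 : V →L[ℝ] V) + t • A).det) :=
      ContinuousLinearMap.continuous_det.comp (by fun_prop)
    obtain ⟨C, hC⟩ := hcpt.exists_bound_of_continuousOn hc.continuousOn
    have : IsFiniteMeasure (μ.restrict B) := ⟨by simpa using hμB.lt_top⟩
    refine Integrable.of_bound ((hdetc t).aestronglyMeasurable hBo.measurableSet) C ?_
    exact Filter.Eventually.of_forall fun x => hC _ (by simpa using hbd x)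
  -- small perturbations of the identity preserve the volume of the ball
  obtain ⟨δ, hδ, hdet⟩ : ∃ δ > 0, ∀ A : V →L[ℝ] V, ‖A‖ < δ → 0 < ((1 : V →L[ℝ] V) + A).det := by
    have hc : Continuous (fun A : V →L[ℝ] V => ((1 : V →L[ℝ] V) + A).det) :=
      ContinuousLinearMap.continuous_det.comp (by fun_prop)
    have h1 : 0 < ((1 : V →L[ℝ] V) + 0).det := by
      rw [add_zero]
      have : (1 : V →L[ℝ] V).det = 1 := by
        change LinearMap.det (LinearMap.id) = 1
        exact LinearMap.det_id
      rw [this]; exact one_pos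
    have h2 := (hc.tendsto 0).eventually (lt_mem_nhds h1)
    obtain ⟨δ, hδ, h⟩ := Metric.eventually_nhds_iff.1 h2
    exact ⟨δ, hδ, fun A hA => h (by simpa using hA)⟩
  have hsmall : ∀ t : ℝ, 0 < t → t * K < δ → t * K < 1 →
      ∫ x in B, ((1 : V →L[ℝ] V) + t • fderiv ℝ g x).det ∂μ = μ.real B := by
    intro t ht htδ ht1
    let f : V → V := fun x => x + t • g x
    have happ : ApproximatesLinearOn f ((ContinuousLinearEquiv.refl ℝ V : V ≃L[ℝ] V) : V →L[ℝ] V)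
        univ (t.toNNReal * K) := by
      rw [ApproximatesLinearOn.approximatesLinearOn_iff_lipschitzOnWith, lipschitzOnWith_univ]
      have : (f - ⇑((ContinuousLinearEquiv.refl ℝ V : V ≃L[ℝ] V) : V →L[ℝ] V))
          = fun x => t • g x := by
        ext x; simp [f]
      rw [this]
      refine LipschitzWith.of_dist_le_mul fun x y => ?_
      rw [dist_smul₀, Real.norm_of_nonneg ht.le, NNReal.coe_mul, Real.coe_toNNReal t ht.le, mul_assoc]
      exact mul_le_mul_of_nonneg_left (hK.dist_le_mul x y) ht.le
    have hcc : Subsingleton V ∨ t.toNNReal * K <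
        ‖((ContinuousLinearEquiv.refl ℝ V : V ≃L[ℝ] V).symm : V →L[ℝ] V)‖₊⁻¹ := by
      rcases subsingleton_or_nontrivial V with h | h
      · exact Or.inl h
      · right
        have h1 : ‖((ContinuousLinearEquiv.refl ℝ V : V ≃L[ℝ] V).symm : V →L[ℝ] V)‖₊ = 1 :=
          NNReal.eq (ContinuousLinearMap.norm_id (𝕜 := ℝ) (E := V))
        rw [h1, inv_one, ← NNReal.coe_lt_coe, NNReal.coe_mul, Real.coe_toNNReal t ht.le]
        exact ht1
    have hinj : Function.Injective f := injOn_univ.1 (happ.injOn hcc)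
    have hsurj : Function.Surjective f := happ.surjective hcc
    have hout : ∀ x, x ∉ B → f x = x := fun x hx => by
      have : ρ ≤ ‖x‖ := by simpa [hB] using hx
      simp [f, h0 x this]
    have himg : f '' B = B := by
      ext y
      constructor
      · rintro ⟨x, hx, rfl⟩
        by_contra hy
        have := hinj (hout _ hy)
        rw [this] at hy
        exact hy hx
      · intro hy
        obtain ⟨x, rfl⟩ := hsurj y
        refine ⟨x, ?_, rfl⟩
        by_contra hx
        rw [hout x hx] at hy
        exact hx hy
    have hd : ∀ x ∈ B, HasFDerivWithinAt f ((1 : V →L[ℝ] V) + t • fderiv ℝ g x) B x := fun x hx =>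
      ((hasFDerivAt_id x).add ((hdiff x hx).const_smul t)).hasFDerivWithinAt
    have key := integral_image_eq_integral_abs_det_fderiv_smul μ hBo.measurableSet hd hinj.injOn
      (fun _ => (1 : ℝ))
    rw [himg] at key
    simp only [smul_eq_mul, mul_one, integral_const, measureReal_restrict_apply_univ] at key
    rw [key]
    refine setIntegral_congr_fun hBo.measurableSet fun x _ => ?_
    refine (abs_of_pos (hdet _ ?_)).symm
    rw [norm_smul, Real.norm_of_nonneg ht.le]
    exact lt_of_le_of_lt (mul_le_mul_of_nonneg_left (hbd x) ht.le) htδ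
  -- at time one the determinant vanishes
  have hone : ∀ x ∈ B, ((1 : V →L[ℝ] V) + fderiv ℝ g x).det = 0 := by
    intro x hx
    set A := (1 : V →L[ℝ] V) + fderiv ℝ g x
    have hA : HasFDerivAt (fun y => y + g y) A x := (hasFDerivAt_id x).add (hdiff x hx)
    have hn : ∀ u, ⟪x + g x, A u⟫ = 0 := by
      intro u
      have h1 := hA.norm_sq
      have h2 : HasFDerivAt (fun y => ‖y + g y‖ ^ 2) (0 : V →L[ℝ] ℝ) x := by
        refine (hasFDerivAt_const (ρ ^ 2) x).congr_of_eventuallyEq ?_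
        filter_upwards [hBo.mem_nhds hx] with y hy
        rw [hr y (by simpa [hB] using hy)]
      have h3 := DFunLike.congr_fun (h1.unique h2) u
      simp only [smul_apply, ContinuousLinearMap.comp_apply, innerSL_apply_apply,
        zero_apply] at h3
      simpa using h3
    by_contra hne
    have hu : IsUnit (LinearMap.det (A : V →ₗ[ℝ] V)) := isUnit_iff_ne_zero.2 hne
    have hsurj : Function.Surjective A :=
      (LinearEquiv.ofIsUnitDet (f := (A : V →ₗ[ℝ] V)) (v := Module.finBasis ℝ V)
        (v' := Module.finBasis ℝ V) (by rwa [LinearMap.det_toMatrix])).surjective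
    obtain ⟨u, hu⟩ := hsurj (x + g x)
    have h4 := hn u
    rw [hu, real_inner_self_eq_norm_sq, hr x (by simpa [hB] using hx)] at h4
    exact hρ.ne' (by simpa using h4)
  -- interpolate
  set t₀ : ℝ := min δ 1 / (K + 1) with ht₀
  have hmin : 0 < min δ 1 := lt_min hδ one_pos
  have hK1 : (0 : ℝ) < K + 1 := by positivity
  have ht₀p : 0 < t₀ := div_pos hmin hK1
  have ht₀K : t₀ * K < min δ 1 := by
    rw [ht₀, div_mul_eq_mul_div, div_lt_iff₀ hK1]
    nlinarith
  let v : ℕ → ℝ := fun i => t₀ / (i + 1)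
  have hv : Function.Injective v := by
    intro i j hij
    simp only [v] at hij
    rw [div_eq_div_iff (by positivity) (by positivity)] at hij
    have := mul_left_cancel₀ ht₀p.ne' hij
    exact_mod_cast (add_right_cancel this).symm
  have hvp : ∀ i, 0 < v i := fun i => by positivity
  have hvle : ∀ i, v i ≤ t₀ := fun i => div_le_self ht₀p.le (by linarith [Nat.cast_nonneg (α := ℝ) i])
  have hvK : ∀ i, v i * K < min δ 1 := fun i =>
    lt_of_le_of_lt (mul_le_mul_of_nonneg_right (hvle i) K.2) ht₀K
  have hz : ∫ x in B, ((1 : V →L[ℝ] V) + fderiv ℝ g x).det ∂μ = 0 := by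
    rw [setIntegral_congr_fun hBo.measurableSet (g := fun _ => (0 : ℝ)) hone, integral_zero]
  have hvol : ∫ x in B, ((1 : V →L[ℝ] V) + fderiv ℝ g x).det ∂μ = μ.real B := by
    rw [setIntegral_congr_fun hBo.measurableSet
      fun x _ => det_one_add_eq_sum_lagrange v hv (fderiv ℝ g x)]
    rw [integral_finsetSum _ fun i _ => (hint (v i)).mul_const _]
    simp_rw [integral_mul_const]
    rw [Finset.sum_congr rfl fun i _ => by
      rw [hsmall (v i) (hvp i) ((hvK i).trans_le (min_le_left _ _))
        ((hvK i).trans_le (min_le_right _ _))]]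
    rw [← Finset.mul_sum, ← Polynomial.eval_finsetSum,
      Lagrange.sum_basis hv.injOn Finset.nonempty_range_add_one, Polynomial.eval_one, mul_one]
  have hpos : 0 < μ.real B :=
    ENNReal.toReal_pos (measure_ball_pos μ 0 hρ).ne' hμB
  linarith


lemma not_retraction {ρ : ℝ} (hρ : 0 < ρ) {g : V → V}
    (hg : ∀ x ∈ closedBall (0 : V) ρ, ContDiffAt ℝ 1 g x)
    (h0 : ∀ x, ‖x‖ = ρ → g x = 0) (hr : ∀ x, ‖x‖ < ρ → ‖x + g x‖ = ρ) : False := by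
  classical
  have hcpt : IsCompact (closedBall (0 : V) ρ) := isCompact_closedBall _ _
  have hfc : ContinuousOn (fun x => fderiv ℝ g x) (closedBall 0 ρ) := fun x hx =>
    ((hg x hx).continuousAt_fderiv one_ne_zero).continuousWithinAt
  obtain ⟨C, hC⟩ := hcpt.exists_bound_of_continuousOn hfc
  have hLip : LipschitzOnWith C.toNNReal g (closedBall 0 ρ) := by
    refine (convex_closedBall (0 : V) ρ).lipschitzOnWith_of_nnnorm_fderiv_le
      (fun x hx => (hg x hx).differentiableAt one_ne_zero) fun x hx => ?_
    rw [← NNReal.coe_le_coe, coe_nnnorm]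
    exact (hC x hx).trans (Real.le_coe_toNNReal C)
  let G : V → V := fun x => if ‖x‖ < ρ then g x else 0
  have hGin : ∀ x ∈ closedBall (0 : V) ρ, G x = g x := by
    intro x hx
    by_cases h : ‖x‖ < ρ
    · simp [G, h]
    · have : ‖x‖ = ρ := le_antisymm (by simpa using hx) (not_lt.1 h)
      simp [G, h, h0 x this]
  have hGout : ∀ x, ρ ≤ ‖x‖ → G x = 0 := fun x hx => by simp [G, not_lt.2 hx]
  have hmix : ∀ x y, ‖x‖ < ρ → ρ ≤ ‖y‖ → dist (G x) (G y) ≤ C.toNNReal * dist x y := by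
    intro x y hx hy
    have hc : ContinuousOn (fun s : ℝ => ‖AffineMap.lineMap x y s‖) (Icc 0 1) := by
      have : Continuous (fun s : ℝ => (AffineMap.lineMap x y s : V)) := AffineMap.lineMap_continuous
      exact this.norm.continuousOn
    have hmem : ρ ∈ Icc ‖(AffineMap.lineMap x y (0 : ℝ) : V)‖ ‖(AffineMap.lineMap x y (1 : ℝ) : V)‖ := by
      simpa using ⟨hx.le, hy⟩
    obtain ⟨s, hs, hsρ⟩ := intermediate_value_Icc zero_le_one hc hmem
    set z : V := AffineMap.lineMap x y s
    have hz : G z = 0 := hGout z (le_of_eq hsρ.symm)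
    have hzb : z ∈ closedBall (0 : V) ρ := by simpa using le_of_eq hsρ
    have hxb : x ∈ closedBall (0 : V) ρ := by simpa using hx.le
    rw [hGout y hy, ← hz, hGin x hxb, hGin z hzb]
    refine (hLip.dist_le_mul x hxb z hzb).trans (mul_le_mul_of_nonneg_left ?_ (NNReal.coe_nonneg _))
    rw [dist_left_lineMap, Real.norm_of_nonneg hs.1]
    exact mul_le_of_le_one_left dist_nonneg hs.2
  refine not_retraction_of_lipschitz hρ (g := G) (K := C.toNNReal) ?_ hGout ?_ ?_
  · refine LipschitzWith.of_dist_le_mul fun x y => ?_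
    rcases lt_or_ge ‖x‖ ρ with hx | hx <;> rcases lt_or_ge ‖y‖ ρ with hy | hy
    · have hxb : x ∈ closedBall (0 : V) ρ := by simpa using hx.le
      have hyb : y ∈ closedBall (0 : V) ρ := by simpa using hy.le
      rw [hGin x hxb, hGin y hyb]
      exact hLip.dist_le_mul x hxb y hyb
    · exact hmix x y hx hy
    · rw [dist_comm, dist_comm x]; exact hmix y x hy hx
    · rw [hGout x hx, hGout y hy, dist_self]; positivity
  · refine ContDiffOn.congr (f := g) (fun x hx => (hg x (ball_subset_closedBall hx)).contDiffWithinAt)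
      fun x hx => hGin x (ball_subset_closedBall hx)
  · intro x hx
    rw [hGin x (by simpa using hx.le)]
    exact hr x hx

lemma exists_fixed_point_of_contDiff {f : V → V} (hf : ContDiff ℝ 1 f) {ρ : ℝ}
    (hρ : 0 < ρ) (hb : ∀ x, ‖f x‖ < ρ) : ∃ x ∈ closedBall (0 : V) ρ, f x = x := by
  by_contra! hne
  let u : V → V := fun x => x - f x
  let D : V → ℝ := fun x => ⟪x, u x⟫ ^ 2 + ‖u x‖ ^ 2 * (ρ ^ 2 - ‖x‖ ^ 2)
  let l : V → ℝ := fun x => (-⟪x, u x⟫ + √(D x)) / ‖u x‖ ^ 2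
  have hu : ContDiff ℝ 1 u := contDiff_id.sub hf
  have hune : ∀ x ∈ closedBall (0 : V) ρ, 0 < ‖u x‖ ^ 2 := fun x hx => by
    have : u x ≠ 0 := sub_ne_zero.2 (hne x hx).symm
    positivity
  have hsph : ∀ x, ‖x‖ = ρ → 0 < ⟪x, u x⟫ := by
    intro x hx
    have h1 : ⟪x, u x⟫ = ρ ^ 2 - ⟪x, f x⟫ := by
      simp only [u, inner_sub_right, real_inner_self_eq_norm_sq, hx]
    have h2 := real_inner_le_norm x (f x)
    rw [hx] at h2
    have h3 := mul_lt_mul_of_pos_left (hb x) hρ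
    nlinarith
  have hD : ∀ x ∈ closedBall (0 : V) ρ, 0 < D x := by
    intro x hx
    have hx' : ‖x‖ ≤ ρ := by simpa using hx
    rcases hx'.eq_or_lt with h | h
    · have := hsph x h
      simp only [D, h]
      nlinarith
    · have h1 : 0 < ρ ^ 2 - ‖x‖ ^ 2 := by nlinarith [norm_nonneg x]
      have := mul_pos (hune x hx) h1
      simp only [D]
      nlinarith [sq_nonneg ⟪x, u x⟫]
  have hDc : ContDiff ℝ 1 D :=
    ((contDiff_id.inner ℝ hu).pow 2).add ((hu.norm_sq ℝ).mul
      (contDiff_const.sub (contDiff_id.norm_sq ℝ)))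
  refine not_retraction hρ (g := fun x => l x • u x) ?_ ?_ ?_
  · intro x hx
    refine ContDiffAt.smul ?_ hu.contDiffAt
    refine ContDiffAt.div ?_ (hu.norm_sq ℝ).contDiffAt (hune x hx).ne'
    exact (contDiff_id.inner ℝ hu).neg.contDiffAt.add (hDc.contDiffAt.sqrt (hD x hx).ne')
  · intro x hx
    have h1 : D x = ⟪x, u x⟫ ^ 2 := by simp [D, hx]
    have h2 : l x = 0 := by
      simp only [l, h1, Real.sqrt_sq (hsph x hx).le]; simp
    simp [h2]
  · intro x hx
    have hxb : x ∈ closedBall (0 : V) ρ := by simpa using hx.le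
    have hs := Real.sq_sqrt (hD x hxb).le
    have hp := hune x hxb
    have hl : l x * ‖u x‖ ^ 2 = -⟪x, u x⟫ + √(D x) := by
      simp only [l]; rw [div_mul_cancel₀ _ hp.ne']
    have h1 : ‖x + l x • u x‖ ^ 2 = ρ ^ 2 := by
      rw [norm_add_sq_real, inner_smul_right, norm_smul, mul_pow, Real.norm_eq_abs, sq_abs]
      have h2 : ‖u x‖ ^ 2 * (‖x‖ ^ 2 + 2 * (l x * ⟪x, u x⟫) + l x ^ 2 * ‖u x‖ ^ 2)
          = ‖u x‖ ^ 2 * ρ ^ 2 := by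
        have h3 : (l x * ‖u x‖ ^ 2 + ⟪x, u x⟫) ^ 2 = D x := by rw [hl, neg_add_eq_sub, sub_add_cancel, hs]
        simp only [D] at h3
        linear_combination h3
      exact mul_left_cancel₀ hp.ne' h2
    exact (sq_eq_sq₀ (norm_nonneg _) hρ.le).1 h1

/-- **Brouwer's fixed point theorem** for bounded maps. -/
theorem exists_fixed_point_of_bounded {f : V → V} (hf : Continuous f) {R : ℝ}
    (hR : ∀ x, ‖f x‖ ≤ R) : ∃ x, f x = x := by
  by_contra! hne
  have hR0 : 0 ≤ R := (norm_nonneg _).trans (hR 0)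
  have hcpt : IsCompact (closedBall (0 : V) (R + 2)) := isCompact_closedBall _ _
  obtain ⟨x₀, -, hx₀⟩ := hcpt.exists_isMinOn ⟨0, by simpa using by linarith⟩
    (continuous_id.dist hf).continuousOn
  have hε : 0 < dist x₀ (f x₀) := dist_pos.2 (hne x₀).symm
  obtain ⟨g, hg, hgf, -⟩ := hf.exists_contDiff_approx 1
    (continuous_const (y := min 1 (dist x₀ (f x₀)))) (fun _ => lt_min one_pos hε)
  obtain ⟨x, hx, hxg⟩ := exists_fixed_point_of_contDiff (f := g) (by exact_mod_cast hg)
    (ρ := R + 2) (by linarith) fun x => by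
      have h1 := (hgf x).trans_le (min_le_left _ _)
      have h2 := norm_sub_norm_le (g x) (f x)
      rw [← dist_eq_norm] at h2
      linarith [hR x]
  have h1 : dist x₀ (f x₀) ≤ dist x (f x) := hx₀ hx
  have h2 := (hgf x).trans_le (min_le_right _ _)
  rw [hxg] at h2
  exact absurd h2 (not_lt.2 h1)

theorem exists_fixed_point_of_bounded' {X : Type*} [NormedAddCommGroup X] [NormedSpace ℝ X]
    [FiniteDimensional ℝ X] {f : X → X} (hf : Continuous f) {R : ℝ} (hR : ∀ x, ‖f x‖ ≤ R) :
    ∃ x, f x = x := by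
  let φ := toEuclidean (E := X)
  obtain ⟨y, hy⟩ := exists_fixed_point_of_bounded (f := fun y => φ (f (φ.symm y)))
    (R := ‖(φ : X →L[ℝ] EuclideanSpace ℝ (Fin (Module.finrank ℝ X)))‖ * R) (by fun_prop) fun y =>
      ((φ : X →L[ℝ] EuclideanSpace ℝ (Fin (Module.finrank ℝ X))).le_opNorm _).trans (mul_le_mul_of_nonneg_left (hR _) (norm_nonneg _))
  exact ⟨φ.symm y, φ.injective (by simpa using hy)⟩

end Brouwer

section Linking
open Set Metric

variable {V : Type*} [NormedAddCommGroup V] [InnerProductSpace ℝ V] [FiniteDimensional ℝ V]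

/-- A linking theorem producing almost critical points at positive level; `g` plays the role of
the gradient of `Φ`. -/
theorem exists_almost_critical_of_linking (U : Submodule ℝ V) (P : V →L[ℝ] U) (e : V)
    {ν Φ : V → ℝ} {g : V → V} {L α β R ε : ℝ}
    (hP : ∀ u : U, P u = u) (hPe : P e = 0) (hν : Continuous ν)
    (hνe : ∀ (u : U) (s : ℝ), 0 ≤ s → ν (u + s • e) = s)
    (hΦ : Continuous Φ) (hg : Continuous g) (hL : 0 < L)
    (hdesc : ∀ x d, Φ (x + d) ≤ Φ x + ⟪g x, d⟫ + L / 2 * ‖d‖ ^ 2)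
    (hα : 0 < α) (hβ : 0 < β) (hε : 0 < ε)
    (hΓ : ∀ y, P y = 0 → ν y = α → β ≤ Φ y)
    (hU : ∀ u : U, Φ u ≤ 0)
    (hR : ∀ (u : U) (s : ℝ), 0 ≤ s → 0 < Φ (u + s • e) → ‖u‖ ≤ R ∧ s ≤ R) :
    ∃ x, β ≤ Φ x ∧ ‖g x‖ < ε := by
  by_contra! hne
  let χ : V → ℝ := fun x => min 1 (max 0 (Φ x / β))
  have hχ0 : ∀ x, 0 ≤ χ x := fun x => le_min zero_le_one (le_max_left _ _)
  have hχ1 : ∀ x, χ x ≤ 1 := fun x => min_le_left _ _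
  have hχneg : ∀ x, Φ x ≤ 0 → χ x = 0 := fun x hx => by
    have : Φ x / β ≤ 0 := div_nonpos_of_nonpos_of_nonneg hx hβ.le
    simp [χ, max_eq_left this]
  have hχpos : ∀ x, β ≤ Φ x → χ x = 1 := fun x hx => by
    have : 1 ≤ Φ x / β := (one_le_div hβ).2 hx
    simp [χ, this]
  have hχc : Continuous χ := by fun_prop
  let T : V → V := fun x => x + (-(χ x / L)) • g x
  have hTc : Continuous T := by fun_prop
  have hTfix : ∀ x, Φ x ≤ 0 → T x = x := fun x hx => by simp [T, hχneg x hx]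
  have hT : ∀ x, Φ (T x) ≤ Φ x - χ x / (2 * L) * ‖g x‖ ^ 2 := by
    intro x
    refine (hdesc x _).trans ?_
    rw [inner_smul_right, real_inner_self_eq_norm_sq, norm_smul, mul_pow, Real.norm_eq_abs, sq_abs]
    have h1 : L / 2 * ((-(χ x / L)) ^ 2 * ‖g x‖ ^ 2) = χ x / (2 * L) * ‖g x‖ ^ 2 * χ x := by
      field_simp
    have h2 : χ x / (2 * L) * ‖g x‖ ^ 2 * χ x ≤ χ x / (2 * L) * ‖g x‖ ^ 2 :=
      mul_le_of_le_one_right (mul_nonneg (div_nonneg (hχ0 x) (by positivity)) (sq_nonneg _)) (hχ1 x)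
    have h3 : -(χ x / L) * ‖g x‖ ^ 2 = -(2 * (χ x / (2 * L) * ‖g x‖ ^ 2)) := by
      field_simp
    rw [h1, h3]
    linarith
  have hTle : ∀ x, Φ (T x) ≤ Φ x := fun x => (hT x).trans
    (sub_le_self _ (mul_nonneg (div_nonneg (hχ0 x) (by positivity)) (sq_nonneg _)))
  set η : ℝ := ε ^ 2 / (2 * L) with hη
  have hηp : 0 < η := by positivity
  have hTdec : ∀ x, β ≤ Φ x → Φ (T x) ≤ Φ x - η := by
    intro x hx
    have h1 := hT x
    rw [hχpos x hx] at h1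
    have h2 : ε ^ 2 ≤ ‖g x‖ ^ 2 := by gcongr; exact hne x hx
    have h3 : η ≤ 1 / (2 * L) * ‖g x‖ ^ 2 := by
      rw [hη, div_eq_mul_one_div, mul_comm]; gcongr
    linarith
  have hiter : ∀ (k : ℕ) x, β ≤ Φ (T^[k] x) → β + k * η ≤ Φ x := by
    intro k
    induction k with
    | zero => intro x hx; simpa using hx
    | succ k ih =>
      intro x hx
      rw [Function.iterate_succ_apply] at hx
      have h1 := ih _ hx
      have h2 : β ≤ Φ x := by
        have : (0 : ℝ) ≤ k * η := by positivity
        linarith [hTle x]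
      have := hTdec x h2
      push_cast
      linarith
  let ℓ : U × ℝ → V := fun p => (p.1 : V) + p.2 • e
  have hℓ : Continuous ℓ := by fun_prop
  have hcpt : IsCompact (closedBall (0 : U) R ×ˢ Icc (0 : ℝ) R) :=
    (isCompact_closedBall _ _).prod isCompact_Icc
  obtain ⟨M, hM⟩ := hcpt.exists_bound_of_continuousOn (hΦ.comp hℓ).continuousOn
  obtain ⟨k, hk⟩ := exists_nat_gt (M / η)
  rw [div_lt_iff₀ hηp] at hk
  have hlow : ∀ (u : U) (s : ℝ), 0 ≤ s → Φ (T^[k] (u + s • e)) < β := by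
    intro u s hs
    by_contra! h
    have h1 := hiter k _ h
    have h2 : 0 < Φ (u + s • e) := by
      have : (0 : ℝ) ≤ k * η := by positivity
      linarith
    obtain ⟨h3, h4⟩ := hR u s hs h2
    have h5 := hM (u, s) ⟨by simpa using h3, hs, h4⟩
    have h6 := (le_abs_self _).trans h5
    simp only [ℓ, Function.comp] at h6
    linarith
  have hTk : Continuous T^[k] := hTc.iterate k
  have hTkfix : ∀ x, Φ x ≤ 0 → T^[k] x = x := fun x hx =>
    Function.iterate_fixed (hTfix x hx) k
  let f₀ : U × ℝ → U × ℝ := fun p => (p.1 - P (T^[k] (ℓ p)), p.2 - ν (T^[k] (ℓ p)) + α)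
  have hf₀ : Continuous f₀ := by fun_prop
  let f : U × ℝ → U × ℝ := fun p => f₀ (p.1, max p.2 0)
  obtain ⟨C, hC⟩ := hcpt.exists_bound_of_continuousOn hf₀.continuousOn
  obtain ⟨⟨u, s⟩, hfix⟩ := exists_fixed_point_of_bounded' (f := f) (R := max C α)
    (by fun_prop) fun p => by
      obtain ⟨u, s⟩ := p
      have hs : 0 ≤ max s 0 := le_max_right _ _
      simp only [f]
      by_cases h : 0 < Φ (u + (max s 0) • e)
      · obtain ⟨h1, h2⟩ := hR u _ hs h
        exact (hC (u, max s 0) ⟨by simpa using h1, hs, h2⟩).trans (le_max_left _ _)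
      · have h1 : T^[k] (ℓ (u, max s 0)) = ℓ (u, max s 0) := hTkfix _ (not_lt.1 h)
        have h2 : ν (ℓ (u, max s 0)) = max s 0 := hνe u _ hs
        have h3 : P (ℓ (u, max s 0)) = u := by simp [ℓ, hP, hPe]
        simp only [f₀, h1, h2, h3, sub_self, zero_add, Prod.norm_mk, norm_zero,
          Real.norm_of_nonneg hα.le]
        exact (max_eq_right hα.le).le.trans (le_max_right _ _)
  have h1 : P (T^[k] (ℓ (u, max s 0))) = 0 := by simpa [f, f₀] using congrArg Prod.fst hfix
  have h2 : max s 0 - ν (T^[k] (ℓ (u, max s 0))) + α = s := congrArg Prod.snd hfix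
  have hs : 0 ≤ s := by
    by_contra! hs
    have h3 : ℓ (u, max s 0) = u + (0 : ℝ) • e := by simp [ℓ, max_eq_right hs.le]
    have h4 : Φ (u + (0 : ℝ) • e) ≤ 0 := by simpa using hU u
    rw [h3, hTkfix _ h4, hνe u 0 le_rfl, max_eq_right hs.le] at h2
    linarith
  rw [max_eq_left hs] at h1 h2
  exact absurd (hΓ _ h1 (by linarith)) (not_le.2 (hlow u s hs))

end Linking

section TrigLoops
open Set MeasureTheory

variable {ι : Type*} [Fintype ι]

/-- The character `t ↦ exp (2 π i k t)`. -/
def wave (k : ℤ) (t : ℝ) : ℂ := Complex.exp (2 * Real.pi * k * t * Complex.I)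

lemma wave_eq (k : ℤ) (t : ℝ) :
    wave k t = Complex.exp (((2 * Real.pi * k * t : ℝ) : ℂ) * Complex.I) := by
  simp [wave]

lemma norm_wave (k : ℤ) (t : ℝ) : ‖wave k t‖ = 1 := by
  rw [wave_eq, Complex.norm_exp_ofReal_mul_I]

lemma conj_wave (k : ℤ) (t : ℝ) : (starRingEnd ℂ) (wave k t) = wave (-k) t := by
  rw [wave_eq, wave_eq, ← Complex.exp_conj, map_mul, Complex.conj_ofReal, Complex.conj_I]
  congr 1
  push_cast
  ring

lemma wave_mul (k l : ℤ) (t : ℝ) : wave k t * wave l t = wave (k + l) t := by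
  rw [wave, wave, wave, ← Complex.exp_add]
  congr 1
  push_cast
  ring

@[simp] lemma wave_zero_left (t : ℝ) : wave 0 t = 1 := by simp [wave]

@[simp] lemma wave_zero_right (k : ℤ) : wave k 0 = 1 := by simp [wave]

@[simp] lemma wave_one_right (k : ℤ) : wave k 1 = 1 := by
  rw [wave]
  convert Complex.exp_int_mul_two_pi_mul_I k using 2
  push_cast
  ring

lemma hasDerivAt_wave (k : ℤ) (t : ℝ) :
    HasDerivAt (wave k) ((2 * Real.pi * k * Complex.I) * wave k t) t := by
  have h1 : HasDerivAt (fun s : ℝ => (2 * Real.pi * k * s * Complex.I : ℂ))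
      (2 * Real.pi * k * Complex.I) t := by
    have := ((hasDerivAt_id t).ofReal_comp.const_mul (2 * Real.pi * k : ℂ)).mul_const Complex.I
    simpa using this
  have h2 := h1.cexp
  rw [mul_comm]
  exact h2

@[fun_prop]
lemma continuous_wave (k : ℤ) : Continuous (wave k) := by
  unfold wave; fun_prop

lemma integral_wave {k : ℤ} (hk : k ≠ 0) : ∫ t in (0 : ℝ)..1, wave k t = 0 := by
  have hc : (2 * Real.pi * k * Complex.I : ℂ) ≠ 0 := by
    have : (Real.pi : ℂ) ≠ 0 := by exact_mod_cast Real.pi_ne_zero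
    have : (k : ℂ) ≠ 0 := by exact_mod_cast hk
    simp_all
  have h := intervalIntegral.integral_eq_sub_of_hasDerivAt
    (fun t _ => hasDerivAt_wave k t) (by
      apply Continuous.intervalIntegrable
      fun_prop : IntervalIntegrable _ volume 0 1)
  rw [intervalIntegral.integral_const_mul] at h
  simpa [hc] using h

lemma inner_smul_left_conj (a : ℂ) (x y : EuclideanSpace ℂ ι) :
    ⟪a • x, y⟫ = ⟪x, (starRingEnd ℂ a) • y⟫ := by
  simp only [PiLp.inner_apply, Complex.inner, PiLp.smul_apply, smul_eq_mul, map_mul]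
  refine Finset.sum_congr rfl fun i _ => ?_
  congr 1
  ring

/-- Trigonometric polynomials with frequencies in `K`. -/
abbrev Trig (ι : Type*) [Fintype ι] (K : Finset ℤ) : Type _ :=
  PiLp 2 (fun _ : K => EuclideanSpace ℂ ι)

variable {K : Finset ℤ}

/-- The loop with prescribed Fourier coefficients. -/
def loop (c : Trig ι K) (t : ℝ) : EuclideanSpace ℂ ι := ∑ k : K, wave k t • c k

/-- The Fourier coefficients, with frequencies in `K`, of a curve defined on `[0,1]`. -/
def coeff (K : Finset ℤ) (f : ℝ → EuclideanSpace ℂ ι) : Trig ι K :=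
  WithLp.toLp 2 fun k : K => ∫ t in (0 : ℝ)..1, wave (-(k : ℤ)) t • f t

lemma coeff_apply (f : ℝ → EuclideanSpace ℂ ι) (k : K) :
    coeff K f k = ∫ t in (0 : ℝ)..1, wave (-(k : ℤ)) t • f t := rfl

lemma loop_add (c d : Trig ι K) (t : ℝ) : loop (c + d) t = loop c t + loop d t := by
  simp [loop, Finset.sum_add_distrib]

@[simp] lemma loop_zero (t : ℝ) : loop (0 : Trig ι K) t = 0 := by
  simp [loop]

@[fun_prop]
lemma continuous_loop (c : Trig ι K) : Continuous (loop c) := by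
  unfold loop; fun_prop

lemma continuous_loop_uncurry : Continuous (fun p : Trig ι K × ℝ => loop p.1 p.2) := by
  unfold loop
  refine continuous_finsetSum _ fun k _ => ?_
  have := continuous_wave (k : ℤ)
  fun_prop

lemma loop_one (c : Trig ι K) : loop c 1 = loop c 0 := by simp [loop]

/-- The operator `-i d/dt` on Fourier coefficients. -/
def freqOp (ι : Type*) [Fintype ι] (K : Finset ℤ) : Trig ι K →L[ℝ] Trig ι K :=
  LinearMap.toContinuousLinearMap
    { toFun := fun c => WithLp.toLp 2 fun k : K => (2 * Real.pi * (k : ℤ) : ℝ) • c k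
      map_add' := fun c d => by ext k : 1; simp
      map_smul' := fun a c => by ext k : 1; simp [smul_comm a] }

lemma freqOp_apply (c : Trig ι K) (k : K) :
    freqOp ι K c k = (2 * Real.pi * (k : ℤ) : ℝ) • c k := rfl

lemma hasDerivAt_loop (c : Trig ι K) (t : ℝ) :
    HasDerivAt (loop c) (Complex.I • loop (freqOp ι K c) t) t := by
  have h : ∀ k : K, HasDerivAt (fun s => wave k s • c k)
      (((2 * Real.pi * (k : ℤ) * Complex.I) * wave k t) • c k) t :=
    fun k => (hasDerivAt_wave k t).smul_const (c k)
  have h2 := HasDerivAt.fun_sum (u := Finset.univ) fun k _ => h k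
  refine h2.congr_deriv ?_
  rw [loop, Finset.smul_sum]
  refine Finset.sum_congr rfl fun k _ => ?_
  rw [freqOp_apply, ← Complex.coe_smul, smul_smul, smul_smul]
  congr 1
  push_cast
  ring

lemma inner_loop (w : EuclideanSpace ℂ ι) (d : Trig ι K) (t : ℝ) :
    ⟪w, loop d t⟫ = ∑ k : K, ⟪wave (-(k : ℤ)) t • w, d k⟫ := by
  rw [loop, inner_sum]
  refine Finset.sum_congr rfl fun k _ => ?_
  rw [inner_smul_left_conj, conj_wave, neg_neg]

lemma inner_coeff {f : ℝ → EuclideanSpace ℂ ι} (hf : Continuous f) (d : Trig ι K) :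
    ⟪coeff K f, d⟫ = ∫ t in (0 : ℝ)..1, ⟪f t, loop d t⟫ := by
  simp_rw [inner_loop]
  rw [intervalIntegral.integral_finsetSum]
  · rw [PiLp.inner_apply]
    refine Finset.sum_congr rfl fun k _ => ?_
    rw [coeff_apply, intervalIntegral.integral_of_le zero_le_one,
      intervalIntegral.integral_of_le zero_le_one, real_inner_comm, ← integral_inner]
    · simp_rw [real_inner_comm]
    · have : Continuous fun t => wave (-(k : ℤ)) t • f t := by fun_prop
      exact (this.intervalIntegrable (μ := volume) 0 1).1
  · intro k _
    apply Continuous.intervalIntegrable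
    fun_prop

lemma coeff_loop (c : Trig ι K) : coeff K (loop c) = c := by
  ext k : 1
  rw [coeff_apply]
  simp_rw [loop, Finset.smul_sum, smul_smul, wave_mul]
  rw [intervalIntegral.integral_finsetSum]
  · rw [Finset.sum_eq_single k]
    · simp
    · intro l _ hl
      rw [intervalIntegral.integral_smul_const, integral_wave, zero_smul]
      intro h
      apply hl
      ext
      linarith
    · simp
  · intro l _
    apply Continuous.intervalIntegrable
    fun_prop

lemma integral_inner_loop (c d : Trig ι K) :
    ∫ t in (0 : ℝ)..1, ⟪loop c t, loop d t⟫ = ⟪c, d⟫ := by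
  rw [← inner_coeff (continuous_loop c), coeff_loop]

lemma integral_norm_sq_loop (c : Trig ι K) :
    ∫ t in (0 : ℝ)..1, ‖loop c t‖ ^ 2 = ‖c‖ ^ 2 := by
  simp_rw [← real_inner_self_eq_norm_sq]
  exact integral_inner_loop c c

/-- Bessel's inequality. -/
lemma norm_sq_coeff_le {f : ℝ → EuclideanSpace ℂ ι} (hf : Continuous f) :
    ‖coeff K f‖ ^ 2 ≤ ∫ t in (0 : ℝ)..1, ‖f t‖ ^ 2 := by
  have h1 : ‖coeff K f‖ ^ 2 = ∫ t in (0 : ℝ)..1, ⟪f t, loop (coeff K f) t⟫ := by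
    rw [← inner_coeff hf, real_inner_self_eq_norm_sq]
  have h2 : ∫ t in (0 : ℝ)..1, ⟪f t, loop (coeff K f) t⟫ ≤
      ∫ t in (0 : ℝ)..1, (1 / 2 * ‖f t‖ ^ 2 + 1 / 2 * ‖loop (coeff K f) t‖ ^ 2) := by
    apply intervalIntegral.integral_mono_on zero_le_one
    · apply Continuous.intervalIntegrable; fun_prop
    · apply Continuous.intervalIntegrable; fun_prop
    · intro t _
      nlinarith [real_inner_le_norm (f t) (loop (coeff K f) t),
        sq_nonneg (‖f t‖ - ‖loop (coeff K f) t‖)]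
  rw [intervalIntegral.integral_add, intervalIntegral.integral_const_mul,
    intervalIntegral.integral_const_mul, integral_norm_sq_loop] at h2
  · linarith
  · apply Continuous.intervalIntegrable; fun_prop
  · apply Continuous.intervalIntegrable; fun_prop

lemma norm_coeff_le {f : ℝ → EuclideanSpace ℂ ι} (hf : Continuous f) {C : ℝ}
    (hC : ∀ t, ‖f t‖ ≤ C) : ‖coeff K f‖ ≤ C := by
  have hC0 : 0 ≤ C := (norm_nonneg _).trans (hC 0)
  refine (sq_le_sq₀ (norm_nonneg _) hC0).1 ((norm_sq_coeff_le hf).trans ?_)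
  have : ∫ t in (0 : ℝ)..1, ‖f t‖ ^ 2 ≤ ∫ t in (0 : ℝ)..1, C ^ 2 := by
    apply intervalIntegral.integral_mono_on zero_le_one
    · apply Continuous.intervalIntegrable; fun_prop
    · exact intervalIntegrable_const
    · intro t _
      have := hC t
      gcongr
  simpa using this

lemma coeff_add {f g : ℝ → EuclideanSpace ℂ ι} (hf : Continuous f) (hg : Continuous g) :
    coeff K (fun t => f t + g t) = coeff K f + coeff K g := by
  ext k : 1
  rw [PiLp.add_apply, coeff_apply, coeff_apply, coeff_apply]
  simp_rw [smul_add]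
  apply intervalIntegral.integral_add <;>
  · apply Continuous.intervalIntegrable; fun_prop

end TrigLoops

section Galerkin
open Set MeasureTheory

variable {ι : Type*} [Fintype ι] {K : Finset ℤ}

/-- A linear map applied to each Fourier coefficient. -/
def mapTrig (A : EuclideanSpace ℂ ι →L[ℂ] EuclideanSpace ℂ ι) (c : Trig ι K) : Trig ι K :=
  WithLp.toLp 2 fun k => A (c k)

lemma mapTrig_apply (A : EuclideanSpace ℂ ι →L[ℂ] EuclideanSpace ℂ ι) (c : Trig ι K) (k : K) :
    mapTrig A c k = A (c k) := rfl

lemma loop_mapTrig (A : EuclideanSpace ℂ ι →L[ℂ] EuclideanSpace ℂ ι) (c : Trig ι K) (t : ℝ) :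
    loop (mapTrig A c) t = A (loop c t) := by
  simp [loop, mapTrig_apply]

/-- The part of a trigonometric polynomial with frequencies in `S`. -/
def cutTrig (S : Set ℤ) [DecidablePred (· ∈ S)] : Trig ι K →L[ℝ] Trig ι K :=
  LinearMap.toContinuousLinearMap
    { toFun := fun c => WithLp.toLp 2 fun k : K => if (k : ℤ) ∈ S then c k else 0
      map_add' := fun c d => by
        ext k : 1
        by_cases h : (k : ℤ) ∈ S <;> simp [h]
      map_smul' := fun a c => by
        ext k : 1
        by_cases h : (k : ℤ) ∈ S <;> simp [h] }

lemma cutTrig_apply (S : Set ℤ) [DecidablePred (· ∈ S)] (c : Trig ι K) (k : K) :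
    cutTrig S c k = if (k : ℤ) ∈ S then c k else 0 := rfl

lemma norm_sq_trig (c : Trig ι K) : ‖c‖ ^ 2 = ∑ k : K, ‖c k‖ ^ 2 := by
  rw [PiLp.norm_sq_eq_of_L2]

lemma norm_le_trig (c : Trig ι K) (k : K) : ‖c k‖ ≤ ‖c‖ := PiLp.norm_apply_le c k

lemma inner_freqOp (c : Trig ι K) :
    ⟪freqOp ι K c, c⟫ = ∑ k : K, 2 * Real.pi * (k : ℤ) * ‖c k‖ ^ 2 := by
  rw [PiLp.inner_apply]
  refine Finset.sum_congr rfl fun k _ => ?_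
  rw [freqOp_apply, inner_smul_left, real_inner_self_eq_norm_sq]
  rfl

/-- The symplectic action of a loop. -/
def action (H : EuclideanSpace ℂ ι → ℝ) (c : Trig ι K) : ℝ :=
  1 / 2 * ⟪freqOp ι K c, c⟫ - ∫ t in (0 : ℝ)..1, H (loop c t)

/-- The gradient of the action. -/
def actionGrad (G : EuclideanSpace ℂ ι → EuclideanSpace ℂ ι) (c : Trig ι K) : Trig ι K :=
  freqOp ι K c - coeff K (fun t => G (loop c t))

variable {H : EuclideanSpace ℂ ι → ℝ} {G : EuclideanSpace ℂ ι → EuclideanSpace ℂ ι} {L : ℝ}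

lemma inner_freqOp_comm (c d : Trig ι K) : ⟪freqOp ι K c, d⟫ = ⟪c, freqOp ι K d⟫ := by
  rw [PiLp.inner_apply, PiLp.inner_apply]
  refine Finset.sum_congr rfl fun k _ => ?_
  rw [freqOp_apply, freqOp_apply, real_inner_smul_left, real_inner_smul_right]

lemma action_add_le (hH : Continuous H) (hG : Continuous G)
    (hT : ∀ z w, |H (z + w) - H z - ⟪G z, w⟫| ≤ L * ‖w‖ ^ 2) (c d : Trig ι K) :
    action H (c + d) ≤ action H c + ⟪actionGrad G c, d⟫
      + (2 * L + ‖freqOp ι K‖) / 2 * ‖d‖ ^ 2 := by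
  have h1 : ⟪freqOp ι K (c + d), c + d⟫ =
      ⟪freqOp ι K c, c⟫ + 2 * ⟪freqOp ι K c, d⟫ + ⟪freqOp ι K d, d⟫ := by
    rw [map_add, inner_add_left, inner_add_right, inner_add_right, inner_freqOp_comm d c,
      real_inner_comm (freqOp ι K c) d]
    ring
  have h2 : ⟪freqOp ι K d, d⟫ ≤ ‖freqOp ι K‖ * ‖d‖ ^ 2 := by
    refine (real_inner_le_norm _ _).trans ?_
    rw [pow_two, ← mul_assoc]
    gcongr
    exact ContinuousLinearMap.le_opNorm _ _
  have h3 : ∫ t in (0 : ℝ)..1, (H (loop c t) + ⟪G (loop c t), loop d t⟫ - L * ‖loop d t‖ ^ 2) ≤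
      ∫ t in (0 : ℝ)..1, H (loop (c + d) t) := by
    apply intervalIntegral.integral_mono_on zero_le_one
    · apply Continuous.intervalIntegrable; fun_prop
    · apply Continuous.intervalIntegrable; fun_prop
    · intro t _
      rw [loop_add]
      have := (abs_le.1 (hT (loop c t) (loop d t))).1
      linarith
  rw [intervalIntegral.integral_sub, intervalIntegral.integral_add,
    intervalIntegral.integral_const_mul, integral_norm_sq_loop,
    ← inner_coeff (f := fun t => G (loop c t)) (by fun_prop)] at h3
  · rw [action, action, actionGrad, inner_sub_left, h1]
    linarith
  all_goals apply Continuous.intervalIntegrable; fun_prop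

lemma continuous_integral_loop {Y : Type*} [NormedAddCommGroup Y] [NormedSpace ℝ Y]
    {F : ℝ → EuclideanSpace ℂ ι → Y} (hF : Continuous (Function.uncurry F)) :
    Continuous fun c : Trig ι K => ∫ t in (0 : ℝ)..1, F t (loop c t) := by
  apply intervalIntegral.continuous_parametric_intervalIntegral_of_continuous'
  exact hF.comp (continuous_snd.prodMk continuous_loop_uncurry)

lemma continuous_action (hH : Continuous H) : Continuous (action (K := K) H) := by
  unfold action
  refine Continuous.sub ?_ (continuous_integral_loop (F := fun _ z => H z) ?_)
  · fun_prop
  · exact hH.comp continuous_snd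

lemma continuous_actionGrad (hG : Continuous G) : Continuous (actionGrad (K := K) G) := by
  unfold actionGrad
  refine Continuous.sub (by fun_prop) ?_
  unfold coeff
  refine (PiLp.continuous_toLp 2 _).comp (continuous_pi fun k => ?_)
  refine continuous_integral_loop (F := fun t z => wave (-(k : ℤ)) t • G z) ?_
  have := continuous_wave (-(k : ℤ))
  exact (this.comp continuous_fst).smul (hG.comp continuous_snd)

/-- Vanishing of the Hamiltonian near the origin and a quadratic upper bound give a positive lower
bound for the action on a small sphere of positive frequency loops, uniformly in `K`. -/
lemma action_lower_bound (hH : Continuous H) (hL : 0 < L)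
    {ρ : ℝ} (hρ : 0 < ρ) (hH0 : ∀ z, ‖z‖ ≤ ρ → H z = 0) (hH2 : ∀ z, H z ≤ L * ‖z‖ ^ 2) :
    ∃ α > 0, ∀ (K : Finset ℤ) (c : Trig ι K), (∀ k : K, (k : ℤ) ≤ 0 → c k = 0) →
      ∑ k : K, (k : ℤ) * ‖c k‖ ^ 2 = α ^ 2 → Real.pi / 2 * α ^ 2 ≤ action H c := by
  obtain ⟨K₀, hK₀⟩ := exists_nat_gt (4 * L * 2 / Real.pi)
  have hpi := Real.pi_pos
  rw [div_lt_iff₀ hpi] at hK₀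
  refine ⟨ρ / (2 * (K₀ + 1)), by positivity, fun K c hc hα => ?_⟩
  set α : ℝ := ρ / (2 * (K₀ + 1)) with hαd
  have hαp : 0 < α := by positivity
  have hterm : ∀ k : K, 0 ≤ ((k : ℤ) : ℝ) * ‖c k‖ ^ 2 := fun k => by
    rcases le_or_gt (k : ℤ) 0 with h | h
    · simp [hc k h]
    · have : (0 : ℝ) < ((k : ℤ) : ℝ) := by exact_mod_cast h
      positivity
  have hck : ∀ k : K, ‖c k‖ ≤ α := fun k => by
    rcases le_or_gt (k : ℤ) 0 with h | h
    · simp [hc k h, hαp.le]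
    · have h1 : (1 : ℝ) ≤ ((k : ℤ) : ℝ) := by exact_mod_cast h
      have h2 : ((k : ℤ) : ℝ) * ‖c k‖ ^ 2 ≤ α ^ 2 :=
        hα ▸ Finset.single_le_sum (f := fun k : K => ((k : ℤ) : ℝ) * ‖c k‖ ^ 2)
          (fun k _ => hterm k) (Finset.mem_univ k)
      have h3 : ‖c k‖ ^ 2 ≤ ((k : ℤ) : ℝ) * ‖c k‖ ^ 2 := le_mul_of_one_le_left (sq_nonneg _) h1
      exact (sq_le_sq₀ (norm_nonneg _) hαp.le).1 (h3.trans h2)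
  set lo : Trig ι K := cutTrig (Iic (K₀ : ℤ)) c
  set hi : Trig ι K := cutTrig (Ioi (K₀ : ℤ)) c
  have hlh : lo + hi = c := by
    ext k : 1
    rw [PiLp.add_apply, cutTrig_apply, cutTrig_apply]
    by_cases h : (k : ℤ) ≤ K₀
    · simp [h]
    · simp [h, not_le.1 h]
  have hlo : ∀ t, ‖loop lo t‖ ≤ ρ / 2 := by
    intro t
    rw [loop]
    have h1 : ∀ k : K, ‖wave k t • lo k‖ ≤
        if (k : ℤ) ∈ Finset.Icc (1 : ℤ) K₀ then α else 0 := by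
      intro k
      rw [norm_smul, norm_wave, one_mul, cutTrig_apply]
      by_cases h0 : (k : ℤ) ≤ 0
      · have : ¬ (1 : ℤ) ≤ k := by omega
        simp [hc k h0, this]
      · have h1 : (1 : ℤ) ≤ k := by omega
        by_cases h : (k : ℤ) ≤ K₀
        · simp [h, h1, hck k]
        · simp [h]
    refine (norm_sum_le_of_le _ fun k _ => h1 k).trans ?_
    rw [Finset.sum_coe_sort K fun k : ℤ => if k ∈ Finset.Icc (1 : ℤ) K₀ then α else 0,
      ← Finset.sum_filter, Finset.sum_const]
    have h2 : (Finset.filter (· ∈ Finset.Icc (1 : ℤ) K₀) K).card ≤ K₀ := by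
      refine (Finset.card_le_card (t := Finset.Icc (1 : ℤ) K₀) fun x hx =>
        (Finset.mem_filter.1 hx).2).trans ?_
      simp
    rw [nsmul_eq_mul]
    calc _ ≤ (K₀ : ℝ) * α := by gcongr
      _ ≤ (K₀ + 1 : ℝ) * α := by gcongr; linarith
      _ = ρ / 2 := by rw [hαd]; field_simp
  have hHc : ∀ t, H (loop c t) ≤ 4 * L * ‖loop hi t‖ ^ 2 := by
    intro t
    rw [← hlh, loop_add]
    rcases le_or_gt ‖loop lo t + loop hi t‖ ρ with h | h
    · rw [hH0 _ h]; positivity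
    · refine (hH2 _).trans ?_
      have h1 := norm_add_le (loop lo t) (loop hi t)
      have h2 := hlo t
      have h3 : ‖loop lo t + loop hi t‖ ≤ 2 * ‖loop hi t‖ := by linarith
      calc _ ≤ L * (2 * ‖loop hi t‖) ^ 2 := by gcongr
        _ = _ := by ring
  have hint : ∫ t in (0 : ℝ)..1, H (loop c t) ≤ 4 * L * ‖hi‖ ^ 2 := by
    rw [← integral_norm_sq_loop hi, ← intervalIntegral.integral_const_mul]
    apply intervalIntegral.integral_mono_on zero_le_one
    · apply Continuous.intervalIntegrable; fun_prop
    · apply Continuous.intervalIntegrable; fun_prop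
    · intro t _
      exact hHc t
  have hhi : (K₀ : ℝ) * ‖hi‖ ^ 2 ≤ α ^ 2 := by
    rw [norm_sq_trig, Finset.mul_sum, ← hα]
    refine Finset.sum_le_sum fun k _ => ?_
    rw [cutTrig_apply]
    split_ifs with h
    · have : (K₀ : ℝ) ≤ ((k : ℤ) : ℝ) := by exact_mod_cast (mem_Ioi.1 h).le
      gcongr
    · simpa using hterm k
  have hquad : ⟪freqOp ι K c, c⟫ = 2 * Real.pi * α ^ 2 := by
    rw [inner_freqOp, ← hα, Finset.mul_sum]
    exact Finset.sum_congr rfl fun k _ => by ring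
  rw [action, hquad]
  have h5 : 4 * L * 2 * ‖hi‖ ^ 2 ≤ K₀ * Real.pi * ‖hi‖ ^ 2 := by gcongr
  have h6 : Real.pi * (K₀ * ‖hi‖ ^ 2) ≤ Real.pi * α ^ 2 := by gcongr
  nlinarith

end Galerkin

section Galerkin
open Set MeasureTheory

variable {ι : Type*} [Fintype ι] 
variable {H : EuclideanSpace ℂ ι → ℝ} {G : EuclideanSpace ℂ ι → EuclideanSpace ℂ ι} {L : ℝ}

/-- The trigonometric polynomials without positive frequencies. -/
def nonposTrig (ι : Type*) [Fintype ι] (K : Finset ℤ) : Submodule ℝ (Trig ι K) where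
  carrier := {c | ∀ k : K, 0 < (k : ℤ) → c k = 0}
  add_mem' := fun {c d} hc hd k hk => by simp [hc k hk, hd k hk]
  zero_mem' := fun k _ => rfl
  smul_mem' := fun a c hc k hk => by simp [hc k hk]

variable {K : Finset ℤ}

/-- The projection onto the trigonometric polynomials without positive frequencies. -/
def nonposProj (ι : Type*) [Fintype ι] (K : Finset ℤ) : Trig ι K →L[ℝ] nonposTrig ι K :=
  (cutTrig (Iic (0 : ℤ))).codRestrict (nonposTrig ι K) fun c k hk => by
    rw [cutTrig_apply, if_neg]
    simpa using hk

lemma nonposProj_apply (c : Trig ι K) (k : K) :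
    (nonposProj ι K c : Trig ι K) k = if (k : ℤ) ∈ Iic (0 : ℤ) then c k else 0 := rfl

/-- Almost critical points of the finite dimensional approximations of the action, at a positive
level which does not depend on the approximation. -/
theorem exists_almost_critical_action [DecidableEq ι] (hH : Continuous H) (hG : Continuous G)
    (hL : 0 < L)
    (hT : ∀ z w, |H (z + w) - H z - ⟪G z, w⟫| ≤ L * ‖w‖ ^ 2)
    (hH' : ∀ z, 0 ≤ H z) {ρ : ℝ} (hρ : 0 < ρ) (hH0 : ∀ z, ‖z‖ ≤ ρ → H z = 0)
    (hH2 : ∀ z, H z ≤ L * ‖z‖ ^ 2) (i₀ : ι) {δ C₀ : ℝ} (hδ : 0 < δ)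
    (hlow : ∀ z, δ * ‖z‖ ^ 2 + Real.pi * ‖z i₀‖ ^ 2 - C₀ ≤ H z) :
    ∃ β > 0, ∀ K : Finset ℤ, 1 ∈ K → ∀ ε > 0, ∃ c : Trig ι K,
      β ≤ action H c ∧ ‖actionGrad G c‖ < ε := by
  obtain ⟨α, hα, hact⟩ := action_lower_bound hH hL hρ hH0 hH2
  have hpi := Real.pi_pos
  refine ⟨Real.pi / 2 * α ^ 2, by positivity, fun K hK ε hε => ?_⟩
  let one : K := ⟨1, hK⟩
  let w₀ : EuclideanSpace ℂ ι := EuclideanSpace.single i₀ 1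
  have hw₀ : ‖w₀‖ = 1 := by simp [w₀]
  let e : Trig ι K := WithLp.toLp 2 fun k => if k = one then w₀ else 0
  have he : ∀ k, e k = if k = one then w₀ else 0 := fun k => rfl
  let ν : Trig ι K → ℝ := fun c => √(∑ k : K, max ((k : ℤ) : ℝ) 0 * ‖c k‖ ^ 2)
  have hsum0 : ∀ c : Trig ι K, 0 ≤ ∑ k : K, max ((k : ℤ) : ℝ) 0 * ‖c k‖ ^ 2 := fun c =>
    Finset.sum_nonneg fun k _ => mul_nonneg (le_max_right _ _) (sq_nonneg _)
  have hval : ∀ (u : nonposTrig ι K) (s : ℝ) (k : K),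
      ((u : Trig ι K) + s • e) k = if k = one then s • w₀ else (u : Trig ι K) k := by
    intro u s k
    rw [PiLp.add_apply, PiLp.smul_apply, he]
    split_ifs with h
    · rw [u.2 k (by rw [h]; exact one_pos), zero_add]
    · simp
  have hpos : ∀ k : K, k ≠ one → 0 < (k : ℤ) → ∀ u : nonposTrig ι K, (u : Trig ι K) k = 0 :=
    fun k _ h u => u.2 k h
  -- the quadratic form on the half space
  have hquad : ∀ (u : nonposTrig ι K) (s : ℝ),
      ⟪freqOp ι K ((u : Trig ι K) + s • e), (u : Trig ι K) + s • e⟫ ≤ 2 * Real.pi * s ^ 2 := by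
    intro u s
    rw [inner_freqOp]
    calc _ ≤ ∑ k : K, if k = one then 2 * Real.pi * s ^ 2 else 0 := by
          refine Finset.sum_le_sum fun k _ => ?_
          rw [hval]
          split_ifs with h
          · rw [norm_smul, hw₀, h]
            simp [one]
          · rcases lt_or_ge 0 (k : ℤ) with hk | hk
            · simp [u.2 k hk]
            · have : ((k : ℤ) : ℝ) ≤ 0 := by exact_mod_cast hk
              exact mul_nonpos_of_nonpos_of_nonneg
                (mul_nonpos_of_nonneg_of_nonpos (by positivity) this) (sq_nonneg _)
      _ = _ := by simp
  have hlo : ∀ c : Trig ι K, δ * ‖c‖ ^ 2 + Real.pi * ‖c one i₀‖ ^ 2 - C₀ ≤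
      ∫ t in (0 : ℝ)..1, H (loop c t) := by
    intro c
    let Q : EuclideanSpace ℂ ι →L[ℂ] EuclideanSpace ℂ ι :=
      ContinuousLinearMap.smulRight (EuclideanSpace.proj i₀) w₀
    have hQ : ∀ z, ‖Q z‖ = ‖z i₀‖ := fun z => by
      simp [Q, norm_smul, hw₀]
    have h1 : ‖c one i₀‖ ^ 2 ≤ ∫ t in (0 : ℝ)..1, ‖loop c t i₀‖ ^ 2 := by
      have h := integral_norm_sq_loop (mapTrig Q c)
      simp_rw [loop_mapTrig, hQ] at h
      rw [h]
      have := norm_le_trig (mapTrig Q c) one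
      rw [mapTrig_apply, hQ] at this
      gcongr
    have h2 : ∫ t in (0 : ℝ)..1, (δ * ‖loop c t‖ ^ 2 + Real.pi * ‖loop c t i₀‖ ^ 2 - C₀) ≤
        ∫ t in (0 : ℝ)..1, H (loop c t) := by
      apply intervalIntegral.integral_mono_on zero_le_one
      · apply Continuous.intervalIntegrable; fun_prop
      · apply Continuous.intervalIntegrable; fun_prop
      · intro t _
        exact hlow _
    rw [intervalIntegral.integral_sub, intervalIntegral.integral_add,
      intervalIntegral.integral_const_mul, intervalIntegral.integral_const_mul,
      integral_norm_sq_loop] at h2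
    · simp only [intervalIntegral.integral_const, sub_zero, one_smul] at h2
      have := mul_le_mul_of_nonneg_left h1 hpi.le
      linarith
    all_goals apply Continuous.intervalIntegrable; fun_prop
  have hnorm : ∀ (u : nonposTrig ι K) (s : ℝ), 
      ‖(u : Trig ι K) + s • e‖ ^ 2 = ‖(u : Trig ι K)‖ ^ 2 + s ^ 2 := by
    intro u s
    have h1 : ⟪(u : Trig ι K), e⟫ = 0 := by
      rw [PiLp.inner_apply]
      refine Finset.sum_eq_zero fun k _ => ?_
      rw [he]
      split_ifs with h
      · rw [u.2 k (by rw [h]; exact one_pos), inner_zero_left]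
      · rw [inner_zero_right]
    have h2 : ‖e‖ ^ 2 = 1 := by
      rw [norm_sq_trig, Finset.sum_eq_single one]
      · simp [he, hw₀]
      · intro k _ hk
        simp [he, hk]
      · simp
    rw [norm_add_sq_real, real_inner_smul_right, h1, norm_smul, mul_pow, h2, Real.norm_eq_abs,
      sq_abs]
    ring
  have hΦU : ∀ u : nonposTrig ι K, action H (u : Trig ι K) ≤ 0 := by
    intro u
    have h1 := hquad u 0
    have h2 : 0 ≤ ∫ t in (0 : ℝ)..1, H (loop (u : Trig ι K) t) :=
      intervalIntegral.integral_nonneg zero_le_one fun t _ => hH' _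
    simp only [zero_smul, add_zero] at h1
    rw [action]
    linarith
  refine exists_almost_critical_of_linking (nonposTrig ι K) (nonposProj ι K) e (ν := ν)
    (L := 2 * L + ‖freqOp ι K‖) (α := α) (R := √(C₀ / δ)) ?_ ?_ ?_ ?_ (continuous_action hH)
    (continuous_actionGrad hG) (by positivity) (action_add_le hH hG hT) hα (by positivity) hε
    ?_ hΦU ?_
  · intro u
    ext k : 2
    rw [nonposProj_apply]
    split_ifs with h
    · rfl
    · exact (u.2 k (by simpa using h)).symm
  · ext k : 2
    rw [nonposProj_apply, he]
    by_cases h : k = one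
    · simp [h, one]
    · simp [h]
  · fun_prop
  · intro u s hs
    have : ∑ k : K, max ((k : ℤ) : ℝ) 0 * ‖((u : Trig ι K) + s • e) k‖ ^ 2 = s ^ 2 := by
      rw [Finset.sum_eq_single one]
      · rw [hval, if_pos rfl, norm_smul, hw₀]
        simp [one]
      · intro k _ hk
        rw [hval, if_neg hk]
        rcases lt_or_ge 0 (k : ℤ) with h | h
        · simp [u.2 k h]
        · have : ((k : ℤ) : ℝ) ≤ 0 := by exact_mod_cast h
          simp [max_eq_right this]
      · simp
    simp only [ν]
    rw [this, Real.sqrt_sq hs]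
  · intro y hy hνy
    have hy0 : ∀ k : K, (k : ℤ) ≤ 0 → y k = 0 := by
      intro k hk
      have := congrArg (fun u : nonposTrig ι K => (u : Trig ι K) k) hy
      simpa [nonposProj_apply, hk] using this
    refine hact K y hy0 ?_
    rw [← hνy, Real.sq_sqrt (hsum0 y)]
    refine Finset.sum_congr rfl fun k _ => ?_
    rcases lt_or_ge 0 (k : ℤ) with h | h
    · rw [max_eq_left]
      exact_mod_cast h.le
    · simp [hy0 k h]
  · intro u s hs hpos'
    have h1 := hquad u s
    have h2 := hlo ((u : Trig ι K) + s • e)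
    rw [hval, if_pos rfl, hnorm] at h2
    have h3 : ‖(s • w₀) i₀‖ ^ 2 = s ^ 2 := by simp [w₀]
    rw [h3] at h2
    rw [action] at hpos'
    have h4 : δ * (‖(u : Trig ι K)‖ ^ 2 + s ^ 2) ≤ C₀ := by linarith
    have h5 : ‖(u : Trig ι K)‖ ^ 2 + s ^ 2 ≤ C₀ / δ := by
      rw [le_div_iff₀ hδ]; linarith
    constructor
    · refine Real.le_sqrt_of_sq_le ?_
      have : ‖u‖ = ‖(u : Trig ι K)‖ := rfl
      rw [this]
      nlinarith
    · refine Real.le_sqrt_of_sq_le ?_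
      nlinarith [sq_nonneg ‖(u : Trig ι K)‖]

end Galerkin

section Limits
open Set MeasureTheory Filter Topology

lemma eq_of_fourier_eq_zero {v : ℝ → ℂ} (hv : Continuous v) (h01 : v 0 = v 1)
    (h : ∀ k : ℤ, k ≠ 0 → ∫ t in (0 : ℝ)..1, wave (-k) t * v t = 0) {t : ℝ} (ht : t ∈ Icc (0 : ℝ) 1) :
    v t = v 0 := by
  have key : ∀ s ∈ Ico (0 : ℝ) 1, v s = ∫ t in (0 : ℝ)..1, v t := by
    intro s hs
    let f : C(AddCircle (1 : ℝ), ℂ) := ⟨AddCircle.liftIco 1 0 v,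
      AddCircle.liftIco_continuous (by simpa using h01) hv.continuousOn⟩
    have hcoef : ∀ k : ℤ, fourierCoeff f k = ∫ t in (0 : ℝ)..1, wave (-k) t * v t := by
      intro k
      change fourierCoeff (AddCircle.liftIco 1 0 v) k = _
      rw [fourierCoeff_liftIco_eq, fourierCoeffOn_eq_integral]
      simp only [zero_add, sub_zero, div_one, one_smul, fourier_coe_apply, smul_eq_mul]
      refine intervalIntegral.integral_congr fun t _ => ?_
      simp only [wave]
      congr 2
      push_cast
      ring
    have h0 : ∀ k : ℤ, k ≠ 0 → fourierCoeff f k = 0 := fun k hk => by rw [hcoef, h k hk]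
    have hsum : HasSum (fun i => fourierCoeff f i • fourier i) f :=
      hasSum_fourier_series_of_summable
        (summable_of_ne_finset_zero (s := {0}) fun k hk => h0 k (by simpa using hk))
    have hsum' : HasSum (fun i => fourierCoeff f i • (fourier i : C(AddCircle (1 : ℝ), ℂ)))
        (fourierCoeff f 0 • fourier 0) :=
      hasSum_single 0 fun k hk => by ext z; simp [h0 k hk]
    have heq := hsum.unique hsum'
    have h1 : f (s : AddCircle (1 : ℝ)) = v s :=
      AddCircle.liftIco_coe_apply (by simpa using hs)
    rw [← h1, heq, ContinuousMap.smul_apply, fourier_zero, hcoef]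
    simp
  have k0 := key 0 (by simp)
  rcases eq_or_lt_of_le ht.2 with h1 | h1
  · rw [h1, h01]
  · rw [key t ⟨ht.1, h1⟩, k0]

/-- A form of the Arzelà–Ascoli theorem on the unit interval. -/
lemma exists_subseq_tendsto_of_equicontinuous {W : Type*} [NormedAddCommGroup W]
    [ProperSpace W] {x : ℕ → ℝ → W} (hx : ∀ N, Continuous (x N)) {M : ℝ}
    (hM : ∀ N, ∀ t ∈ Icc (0 : ℝ) 1, ‖x N t‖ ≤ M)
    (heq : ∀ ε > 0, ∃ δ > 0, ∀ N, ∀ s ∈ Icc (0 : ℝ) 1, ∀ t ∈ Icc (0 : ℝ) 1, |s - t| < δ →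
      ‖x N s - x N t‖ < ε) :
    ∃ (φ : ℕ → ℕ) (y : ℝ → W), StrictMono φ ∧ Continuous y ∧
      ∀ t ∈ Icc (0 : ℝ) 1, Tendsto (fun N => x (φ N) t) atTop (𝓝 (y t)) := by
  let X : ℕ → BoundedContinuousFunction (Icc (0 : ℝ) 1) W := fun N =>
    BoundedContinuousFunction.mkOfCompact ⟨fun t => x N t, (hx N).comp continuous_subtype_val⟩
  have hX : ∀ N t, X N t = x N t := fun N t => rfl
  have hcomp := BoundedContinuousFunction.arzela_ascoli (Metric.closedBall (0 : W) M)
    (isCompact_closedBall _ _) (range X)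
    (by
      rintro f t ⟨N, rfl⟩
      rw [mem_closedBall_zero_iff]
      exact hM N t t.2)
    (by
      intro t
      rw [Metric.equicontinuousAt_iff]
      intro ε hε
      obtain ⟨δ, hδ, h⟩ := heq ε hε
      refine ⟨δ, hδ, ?_⟩
      rintro s hs ⟨_, N, rfl⟩
      change dist (x N t) (x N s) < ε
      rw [dist_eq_norm]
      refine h N t t.2 s s.2 ?_
      rw [dist_comm] at hs
      exact hs)
  obtain ⟨f, -, φ, hφ, hlim⟩ := hcomp.tendsto_subseq (x := X)
    fun N => subset_closure (mem_range_self N)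
  refine ⟨φ, IccExtend zero_le_one f, hφ, f.continuous.Icc_extend', fun t ht => ?_⟩
  rw [IccExtend_of_mem _ _ ht]
  have h2 : Continuous fun g : BoundedContinuousFunction (Icc (0 : ℝ) 1) W => g ⟨t, ht⟩ :=
    by fun_prop
  exact (h2.tendsto f).comp hlim

/-- Dominated convergence on the unit interval. -/
lemma tendsto_integral_unit {Y : Type*} [NormedAddCommGroup Y] [NormedSpace ℝ Y]
    {F : ℕ → ℝ → Y} {f : ℝ → Y} (hF : ∀ N, Continuous (F N)) {M : ℝ}
    (hM : ∀ N, ∀ t ∈ Icc (0 : ℝ) 1, ‖F N t‖ ≤ M)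
    (hlim : ∀ t ∈ Icc (0 : ℝ) 1, Tendsto (fun N => F N t) atTop (𝓝 (f t))) :
    Tendsto (fun N => ∫ t in (0 : ℝ)..1, F N t) atTop (𝓝 (∫ t in (0 : ℝ)..1, f t)) := by
  have hsub : ∀ t, t ∈ uIoc (0 : ℝ) 1 → t ∈ Icc (0 : ℝ) 1 := fun t ht => by
    rw [uIoc_of_le zero_le_one] at ht
    exact Ioc_subset_Icc_self ht
  refine intervalIntegral.tendsto_integral_filter_of_dominated_convergence (fun _ => M)
    (Eventually.of_forall fun N => (hF N).aestronglyMeasurable)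
    (Eventually.of_forall fun N => Eventually.of_forall fun t ht => hM N t (hsub t ht))
    intervalIntegrable_const (Eventually.of_forall fun t ht => hlim t (hsub t ht))

variable {ι : Type*} [Fintype ι] {K : Finset ℤ}

lemma norm_loop_sub_le (c : Trig ι K) {η : ℝ} (hη : 0 < η) {s t : ℝ} (hs : s ∈ Icc (0 : ℝ) 1)
    (ht : t ∈ Icc (0 : ℝ) 1) :
    ‖loop c s - loop c t‖ ≤ η * ‖freqOp ι K c‖ ^ 2 + |s - t| / (4 * η) := by
  wlog hst : t ≤ s generalizing s t
  · rw [norm_sub_rev, abs_sub_comm]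
    exact this ht hs (not_le.1 hst).le
  have h1 : ∫ r in t..s, Complex.I • loop (freqOp ι K c) r = loop c s - loop c t :=
    intervalIntegral.integral_eq_sub_of_hasDerivAt (fun r _ => hasDerivAt_loop c r)
      (by apply Continuous.intervalIntegrable; fun_prop)
  have h2 : ∫ r in t..s, ‖Complex.I • loop (freqOp ι K c) r‖ ≤
      ∫ r in t..s, (η * ‖loop (freqOp ι K c) r‖ ^ 2 + 1 / (4 * η)) := by
    apply intervalIntegral.integral_mono_on hst
    · apply Continuous.intervalIntegrable; fun_prop
    · apply Continuous.intervalIntegrable; fun_prop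
    · intro r _
      rw [norm_smul, Complex.norm_I, one_mul]
      set a := ‖loop (freqOp ι K c) r‖
      have : η * a ^ 2 + 1 / (4 * η) - a = (2 * η * a - 1) ^ 2 / (4 * η) := by
        field_simp; ring
      have h3 : 0 ≤ (2 * η * a - 1) ^ 2 / (4 * η) := by positivity
      linarith
  have h3 : ∫ r in t..s, ‖loop (freqOp ι K c) r‖ ^ 2 ≤ ‖freqOp ι K c‖ ^ 2 := by
    rw [← integral_norm_sq_loop]
    apply intervalIntegral.integral_mono_interval ht.1 hst hs.2
    · exact Eventually.of_forall fun r => sq_nonneg _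
    · apply Continuous.intervalIntegrable; fun_prop
  rw [intervalIntegral.integral_add, intervalIntegral.integral_const_mul,
    intervalIntegral.integral_const, smul_eq_mul] at h2
  · rw [← h1]
    refine (intervalIntegral.norm_integral_le_integral_norm hst).trans (h2.trans ?_)
    rw [abs_of_nonneg (by linarith), mul_one_div]
    gcongr
  all_goals apply Continuous.intervalIntegrable; fun_prop

lemma norm_loop_le (c : Trig ι K) {t : ℝ} (ht : t ∈ Icc (0 : ℝ) 1) :
    ‖loop c t‖ ≤ ‖c‖ ^ 2 + ‖freqOp ι K c‖ ^ 2 + 1 := by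
  have h1 : ∫ s in (0 : ℝ)..1, ‖loop c t‖ ≤
      ∫ s in (0 : ℝ)..1, (‖loop c s‖ ^ 2 + (‖freqOp ι K c‖ ^ 2 + 1)) := by
    apply intervalIntegral.integral_mono_on zero_le_one
    · apply Continuous.intervalIntegrable; fun_prop
    · apply Continuous.intervalIntegrable; fun_prop
    · intro s hs
      have h := norm_loop_sub_le c one_pos ht hs
      have h2 : |t - s| ≤ 1 := abs_le.2 ⟨by linarith [ht.1, hs.2], by linarith [ht.2, hs.1]⟩
      have h3 := norm_le_norm_add_norm_sub' (loop c t) (loop c s)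
      nlinarith [sq_nonneg (‖loop c s‖ - 1 / 2)]
  rw [intervalIntegral.integral_add, integral_norm_sq_loop] at h1
  · simp only [intervalIntegral.integral_const, sub_zero, one_smul] at h1
    linarith
  all_goals apply Continuous.intervalIntegrable; fun_prop

end Limits

section Orbit
open Set MeasureTheory Filter Topology

variable {ι : Type*} [Fintype ι] {K : Finset ℤ}
variable {H : EuclideanSpace ℂ ι → ℝ} {G : EuclideanSpace ℂ ι → EuclideanSpace ℂ ι}

lemma norm_trig_le_of_actionGrad (hG : Continuous G)
    {B : EuclideanSpace ℂ ι →L[ℂ] EuclideanSpace ℂ ι} {δ C : ℝ} (hδ : 0 < δ)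
    (hB : ∀ (k : ℤ) w, δ * ‖w‖ ≤ ‖(2 * Real.pi * k : ℝ) • w - B w‖)
    (hC : ∀ z, ‖G z - B z‖ ≤ C) (c : Trig ι K) :
    δ * ‖c‖ ≤ C + ‖actionGrad G c‖ := by
  have h1 : freqOp ι K c - mapTrig B c =
      coeff K (fun t => G (loop c t) - B (loop c t)) + actionGrad G c := by
    have h2 : coeff K (fun t => G (loop c t)) =
        coeff K (fun t => G (loop c t) - B (loop c t)) + coeff K (loop (mapTrig B c)) := by
      rw [← coeff_add (by fun_prop) (by fun_prop)]
      simp [loop_mapTrig]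
    rw [coeff_loop] at h2
    rw [actionGrad, h2]
    abel
  have h3 : δ * ‖c‖ ≤ ‖freqOp ι K c - mapTrig B c‖ := by
    refine (sq_le_sq₀ (by positivity) (norm_nonneg _)).1 ?_
    rw [mul_pow, norm_sq_trig, norm_sq_trig, Finset.mul_sum]
    refine Finset.sum_le_sum fun k _ => ?_
    rw [← mul_pow]
    have := hB k (c k)
    rw [PiLp.sub_apply, freqOp_apply, mapTrig_apply]
    gcongr
  refine h3.trans ?_
  rw [h1]
  refine (norm_add_le _ _).trans ?_
  gcongr
  exact norm_coeff_le (by fun_prop) fun t => hC _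

lemma norm_coeff_comp_loop_le (hG : Continuous G) {L : ℝ} (hL : 0 ≤ L)
    (hGL : ∀ z, ‖G z‖ ≤ L * ‖z‖) (c : Trig ι K) :
    ‖coeff K (fun t => G (loop c t))‖ ≤ L * ‖c‖ := by
  refine (sq_le_sq₀ (norm_nonneg _) (by positivity)).1 ?_
  refine (norm_sq_coeff_le (by fun_prop)).trans ?_
  rw [mul_pow, ← integral_norm_sq_loop, ← intervalIntegral.integral_const_mul]
  apply intervalIntegral.integral_mono_on zero_le_one
  · apply Continuous.intervalIntegrable; fun_prop
  · apply Continuous.intervalIntegrable; fun_prop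
  · intro t _
    rw [← mul_pow]
    have := hGL (loop c t)
    gcongr

/-- If the Fourier coefficients of a continuous closed curve `x` on `[0,1]` satisfy the Fourier
transform of the equation `x' = i g`, then so does `x`. -/
lemma eq_integral_of_fourier {x g : ℝ → EuclideanSpace ℂ ι} (hx : Continuous x)
    (hg : Continuous g) (h01 : x 0 = x 1)
    (h : ∀ k : ℤ, (2 * Real.pi * k : ℝ) • ∫ t in (0 : ℝ)..1, wave (-k) t • x t =
      ∫ t in (0 : ℝ)..1, wave (-k) t • g t) {t : ℝ} (ht : t ∈ Icc (0 : ℝ) 1) :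
    x t = x 0 + ∫ s in (0 : ℝ)..t, Complex.I • g s := by
  set y : ℝ → EuclideanSpace ℂ ι := fun t => x 0 + ∫ s in (0 : ℝ)..t, Complex.I • g s with hy
  have hgI : Continuous fun s => Complex.I • g s := by fun_prop
  have hyd : ∀ t, HasDerivAt y (Complex.I • g t) t := fun t =>
    (intervalIntegral.integral_hasDerivAt_right (hgI.intervalIntegrable _ _)
      (hgI.stronglyMeasurableAtFilter _ _) hgI.continuousAt).const_add _
  have hyc : Continuous y := continuous_iff_continuousAt.2 fun t => (hyd t).continuousAt
  have hy0 : y 0 = x 0 := by simp [hy]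
  have hy1 : y 1 = y 0 := by
    have h0 := h 0
    simp only [Int.cast_zero, mul_zero, zero_smul, neg_zero, wave_zero_left, one_smul] at h0
    simp [hy, intervalIntegral.integral_smul, ← h0]
  have hcoef : ∀ k : ℤ, k ≠ 0 → ∫ t in (0 : ℝ)..1, wave (-k) t • (x t - y t) = 0 := by
    intro k hk
    have hd : ∀ t, HasDerivAt (fun t => wave (-k) t • y t)
        (wave (-k) t • (Complex.I • g t) +
          ((2 * Real.pi * (-k : ℤ) * Complex.I) * wave (-k) t) • y t) t :=
      fun t => (hasDerivAt_wave (-k) t).smul (hyd t)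
    have hint := intervalIntegral.integral_eq_sub_of_hasDerivAt (a := 0) (b := 1)
      (fun t _ => hd t) (by apply Continuous.intervalIntegrable; fun_prop)
    have hc : (2 * Real.pi * k * Complex.I : ℂ) ≠ 0 := by
      have : (Real.pi : ℂ) ≠ 0 := by exact_mod_cast Real.pi_ne_zero
      have : (k : ℂ) ≠ 0 := by exact_mod_cast hk
      simp_all
    rw [intervalIntegral.integral_add] at hint
    · simp only [wave_one_right, wave_zero_right, one_smul, hy1, sub_self, mul_smul] at hint
      simp_rw [smul_comm (wave (-k) _) Complex.I] at hint
      simp only [intervalIntegral.integral_smul] at hint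
      rw [← h k] at hint
      simp_rw [smul_sub]
      rw [intervalIntegral.integral_sub]
      · have h2 : (2 * Real.pi * k * Complex.I : ℂ) •
          ((∫ t in (0 : ℝ)..1, wave (-k) t • x t) - ∫ t in (0 : ℝ)..1, wave (-k) t • y t) = 0 := by
          rw [← hint, ← Complex.coe_smul]
          module
        exact (smul_eq_zero.1 h2).resolve_left hc
      all_goals apply Continuous.intervalIntegrable; fun_prop
    all_goals apply Continuous.intervalIntegrable; fun_prop
  have hconst : ∀ i, (x t - y t) i = (x 0 - y 0) i := by
    intro i
    refine eq_of_fourier_eq_zero (v := fun t => (x t - y t) i) (by fun_prop) ?_ ?_ ht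
    · simp [h01, hy1]
    · intro k hk
      have h2 := congrArg (fun z => (EuclideanSpace.proj i : EuclideanSpace ℂ ι →L[ℂ] ℂ) z) (hcoef k hk)
      rw [← ContinuousLinearMap.intervalIntegral_comp_comm] at h2
      · simpa using h2
      · apply Continuous.intervalIntegrable; fun_prop
  have h3 : x t - y t = x 0 - y 0 := by ext i; exact hconst i
  rw [hy0, sub_self, sub_eq_zero] at h3
  exact h3

/-- Existence of a one-periodic orbit of positive action. -/
theorem exists_periodic_orbit [DecidableEq ι] {L : ℝ} (hL : 0 < L) (hH : Continuous H)
    (hGL : ∀ z w, ‖G z - G w‖ ≤ L * ‖z - w‖) (hG0 : G 0 = 0)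
    (hT : ∀ z w, |H (z + w) - H z - ⟪G z, w⟫| ≤ L * ‖w‖ ^ 2)
    (hH' : ∀ z, 0 ≤ H z) {ρ : ℝ} (hρ : 0 < ρ) (hH0 : ∀ z, ‖z‖ ≤ ρ → H z = 0)
    (i₀ : ι) {δ C₀ C : ℝ} (hδ : 0 < δ)
    (hlow : ∀ z, δ * ‖z‖ ^ 2 + Real.pi * ‖z i₀‖ ^ 2 - C₀ ≤ H z)
    {B : EuclideanSpace ℂ ι →L[ℂ] EuclideanSpace ℂ ι}
    (hB : ∀ (k : ℤ) w, δ * ‖w‖ ≤ ‖(2 * Real.pi * k : ℝ) • w - B w‖)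
    (hC : ∀ z, ‖G z - B z‖ ≤ C) :
    ∃ y : ℝ → EuclideanSpace ℂ ι, Continuous y ∧
      (∀ t ∈ Icc (0 : ℝ) 1, HasDerivAt y (Complex.I • G (y t)) t) ∧ y 0 = y 1 ∧
      0 < ∫ t in (0 : ℝ)..1, (1 / 2 * ⟪G (y t), y t⟫ - H (y t)) := by
  have hG : Continuous G := (LipschitzWith.of_dist_le_mul (K := ⟨L, hL.le⟩) fun z w => by
    rw [dist_eq_norm, dist_eq_norm]; exact hGL z w).continuous
  have hGn : ∀ z, ‖G z‖ ≤ L * ‖z‖ := fun z => by simpa [hG0] using hGL z 0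
  have hHz : H 0 = 0 := hH0 0 (by simpa using hρ.le)
  have hH2 : ∀ z, |H z| ≤ L * ‖z‖ ^ 2 := fun z => by simpa [hG0, hHz] using hT 0 z
  obtain ⟨β, hβ, hex⟩ := exists_almost_critical_action hH hG hL hT hH' hρ hH0
    (fun z => (le_abs_self _).trans (hH2 z)) i₀ hδ hlow
  let KN : ℕ → Finset ℤ := fun N => Finset.Icc (-(N + 1) : ℤ) (N + 1)
  have hex' : ∀ N : ℕ, ∃ c : Trig ι (KN N), β ≤ action H c ∧
      ‖actionGrad G c‖ < 1 / (N + 1 : ℝ) := fun N =>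
    hex (KN N) (by simp only [KN, Finset.mem_Icc]; constructor <;> omega) _ (by positivity)
  choose c hcβ hcg using hex'
  have hcg1 : ∀ N, ‖actionGrad G (c N)‖ ≤ 1 := fun N => (hcg N).le.trans (by
    rw [div_le_one (by positivity)]; linarith [N.cast_nonneg (α := ℝ)])
  have hg0 : Tendsto (fun N => ‖actionGrad G (c N)‖) atTop (𝓝 0) :=
    squeeze_zero (fun N => norm_nonneg _) (fun N => (hcg N).le)
      tendsto_one_div_add_atTop_nhds_zero_nat
  set M₀ : ℝ := (C + 1) / δ
  have hcM : ∀ N, ‖c N‖ ≤ M₀ := fun N => by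
    rw [le_div_iff₀ hδ, mul_comm]
    linarith [norm_trig_le_of_actionGrad hG hδ hB hC (c N), hcg1 N]
  have hM₀ : 0 ≤ M₀ := (norm_nonneg _).trans (hcM 0)
  set M₁ : ℝ := L * M₀ + 1
  have hfM : ∀ N, ‖freqOp ι (KN N) (c N)‖ ≤ M₁ := fun N => by
    have h1 : freqOp ι (KN N) (c N) =
        coeff (KN N) (fun t => G (loop (c N) t)) + actionGrad G (c N) := by
      rw [actionGrad]; abel
    rw [h1]
    refine (norm_add_le _ _).trans (add_le_add ?_ (hcg1 N))
    exact (norm_coeff_comp_loop_le hG hL.le hGn _).trans (by gcongr; exact hcM N)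
  have hM₁ : 0 < M₁ := by positivity
  set M₂ : ℝ := M₀ ^ 2 + M₁ ^ 2 + 1
  have hM₂ : 0 ≤ M₂ := by positivity
  have hxM : ∀ N, ∀ t ∈ Icc (0 : ℝ) 1, ‖loop (c N) t‖ ≤ M₂ := fun N t ht => by
    refine (norm_loop_le _ ht).trans ?_
    have := hcM N
    have := hfM N
    change _ ≤ M₀ ^ 2 + M₁ ^ 2 + 1
    gcongr
  obtain ⟨φ, x, hφ, hx, hlim⟩ := exists_subseq_tendsto_of_equicontinuous
    (x := fun N => loop (c N)) (fun N => continuous_loop _) hxM (by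
      intro ε hε
      set η : ℝ := ε / (2 * M₁ ^ 2) with hη
      have hηp : 0 < η := by positivity
      refine ⟨2 * η * ε, by positivity, fun N s hs t ht hst => ?_⟩
      refine (norm_loop_sub_le _ hηp hs ht).trans_lt ?_
      have h1 : η * ‖freqOp ι (KN N) (c N)‖ ^ 2 ≤ η * M₁ ^ 2 := by
        have := hfM N
        gcongr
      have h2 : η * M₁ ^ 2 = ε / 2 := by rw [hη]; field_simp
      have h3 : |s - t| / (4 * η) < ε / 2 := by
        rw [div_lt_iff₀ (by positivity)]
        linarith
      linarith)
  have hx01 : x 0 = x 1 := by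
    refine tendsto_nhds_unique (hlim 0 (by simp)) ?_
    simpa [loop_one] using hlim 1 (by simp)
  have hGlim : ∀ t ∈ Icc (0 : ℝ) 1,
      Tendsto (fun N => G (loop (c (φ N)) t)) atTop (𝓝 (G (x t))) :=
    fun t ht => (hG.tendsto _).comp (hlim t ht)
  have hGM : ∀ N, ∀ t ∈ Icc (0 : ℝ) 1, ‖G (loop (c N) t)‖ ≤ L * M₂ := fun N t ht =>
    (hGn _).trans (by gcongr; exact hxM N t ht)
  have hfour : ∀ k : ℤ, (2 * Real.pi * k : ℝ) • ∫ t in (0 : ℝ)..1, wave (-k) t • x t =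
      ∫ t in (0 : ℝ)..1, wave (-k) t • G (x t) := by
    intro k
    have h1 : Tendsto (fun N => ∫ t in (0 : ℝ)..1, wave (-k) t • loop (c (φ N)) t) atTop
        (𝓝 (∫ t in (0 : ℝ)..1, wave (-k) t • x t)) := by
      refine tendsto_integral_unit (M := M₂) (fun N => by fun_prop) (fun N t ht => ?_)
        fun t ht => (hlim t ht).const_smul _
      rw [norm_smul, norm_wave, one_mul]
      exact hxM _ t ht
    have h2 : Tendsto (fun N => ∫ t in (0 : ℝ)..1, wave (-k) t • G (loop (c (φ N)) t)) atTop
        (𝓝 (∫ t in (0 : ℝ)..1, wave (-k) t • G (x t))) := by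
      refine tendsto_integral_unit (M := L * M₂) (fun N => by fun_prop) (fun N t ht => ?_)
        fun t ht => (hGlim t ht).const_smul _
      rw [norm_smul, norm_wave, one_mul]
      exact hGM _ t ht
    have h3 := (h1.const_smul (2 * Real.pi * k : ℝ)).sub h2
    have h4 : Tendsto (fun N =>
        (2 * Real.pi * k : ℝ) • (∫ t in (0 : ℝ)..1, wave (-k) t • loop (c (φ N)) t) -
        ∫ t in (0 : ℝ)..1, wave (-k) t • G (loop (c (φ N)) t)) atTop (𝓝 0) := by
      refine squeeze_zero_norm' ?_ (hg0.comp hφ.tendsto_atTop)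
      filter_upwards [eventually_ge_atTop k.natAbs] with N hN
      have hkN : k ∈ KN (φ N) := by
        have := hφ.id_le N
        simp only [id] at this
        simp only [KN, Finset.mem_Icc]
        omega
      have h5 := norm_le_trig (actionGrad G (c (φ N))) ⟨k, hkN⟩
      have h6 : (c (φ N)) ⟨k, hkN⟩ = ∫ t in (0 : ℝ)..1, wave (-k) t • loop (c (φ N)) t := by
        conv_lhs => rw [← coeff_loop (c (φ N)), coeff_apply]
      rw [actionGrad, PiLp.sub_apply, freqOp_apply, coeff_apply, h6] at h5
      exact h5
    exact sub_eq_zero.1 (tendsto_nhds_unique h3 h4)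
  have hact : β ≤ ∫ t in (0 : ℝ)..1, (1 / 2 * ⟪G (x t), x t⟫ - H (x t)) := by
    have h1 : Tendsto
        (fun N => ∫ t in (0 : ℝ)..1, (1 / 2 * ⟪G (loop (c (φ N)) t), loop (c (φ N)) t⟫ -
          H (loop (c (φ N)) t))) atTop
        (𝓝 (∫ t in (0 : ℝ)..1, (1 / 2 * ⟪G (x t), x t⟫ - H (x t)))) := by
      refine tendsto_integral_unit (M := 1 / 2 * (L * M₂ * M₂) + L * M₂ ^ 2)
        (fun N => by fun_prop) (fun N t ht => ?_) fun t ht => ?_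
      · refine (norm_sub_le _ _).trans (add_le_add ?_ ?_)
        · rw [norm_mul, Real.norm_of_nonneg (by norm_num : (0 : ℝ) ≤ 1 / 2)]
          gcongr
          refine (norm_inner_le_norm _ _).trans ?_
          have := hGM (φ N) t ht
          have := hxM (φ N) t ht
          gcongr
        · refine (hH2 _).trans ?_
          have := hxM (φ N) t ht
          gcongr
      · exact (((hGlim t ht).inner (hlim t ht)).const_mul _).sub ((hH.tendsto _).comp (hlim t ht))
    have h2 : Tendsto (fun N => β - 1 / 2 * (‖actionGrad G (c (φ N))‖ * M₀)) atTop (𝓝 β) := by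
      have := (((hg0.comp hφ.tendsto_atTop).mul_const M₀).const_mul (1 / 2)).const_sub β
      simpa using this
    refine le_of_tendsto_of_tendsto' h2 h1 fun N => ?_
    have h3 := hcβ (φ N)
    rw [action] at h3
    have h4 : ⟪freqOp ι (KN (φ N)) (c (φ N)), c (φ N)⟫ =
        (∫ t in (0 : ℝ)..1, ⟪G (loop (c (φ N)) t), loop (c (φ N)) t⟫) +
        ⟪actionGrad G (c (φ N)), c (φ N)⟫ := by
      rw [← inner_coeff (by fun_prop), ← inner_add_left, actionGrad]
      congr 1
      abel
    have h5 : ⟪actionGrad G (c (φ N)), c (φ N)⟫ ≤ ‖actionGrad G (c (φ N))‖ * M₀ := by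
      refine (real_inner_le_norm _ _).trans ?_
      have := hcM (φ N)
      gcongr
    rw [intervalIntegral.integral_sub, intervalIntegral.integral_const_mul]
    · linarith
    all_goals apply Continuous.intervalIntegrable; fun_prop
  -- a globally defined primitive agreeing with the limit on the unit interval
  set y : ℝ → EuclideanSpace ℂ ι := fun t => x 0 + ∫ s in (0 : ℝ)..t, Complex.I • G (x s) with hy
  have hgI : Continuous fun s => Complex.I • G (x s) := by fun_prop
  have hyd : ∀ t, HasDerivAt y (Complex.I • G (x t)) t := fun t =>
    (intervalIntegral.integral_hasDerivAt_right (hgI.intervalIntegrable _ _)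
      (hgI.stronglyMeasurableAtFilter _ _) hgI.continuousAt).const_add _
  have hyx : ∀ t ∈ Icc (0 : ℝ) 1, x t = y t := fun t ht =>
    eq_integral_of_fourier hx (by fun_prop) hx01 hfour ht
  refine ⟨y, continuous_iff_continuousAt.2 fun t => (hyd t).continuousAt, fun t ht => ?_, ?_, ?_⟩
  · rw [← hyx t ht]; exact hyd t
  · rw [← hyx 0 (by simp), ← hyx 1 (by simp), hx01]
  · refine hβ.trans_le (hact.trans_eq (intervalIntegral.integral_congr fun t ht => ?_))
    rw [uIcc_of_le zero_le_one] at ht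
    simp only [hyx t ht]

end Orbit

section Profile
open Set MeasureTheory Filter Topology

lemma hasDerivAt_integral_of_continuous {g : ℝ → ℝ} (hg : Continuous g) (s : ℝ) :
    HasDerivAt (fun s => ∫ u in (0 : ℝ)..s, g u) (g s) s :=
  intervalIntegral.integral_hasDerivAt_right (hg.intervalIntegrable _ _)
    (hg.stronglyMeasurableAtFilter _ _) hg.continuousAt

lemma contDiff_integral {g : ℝ → ℝ} (hg : ContDiff ℝ ∞ g) :
    ContDiff ℝ ∞ (fun s => ∫ u in (0 : ℝ)..s, g u) := by
  have h := hasDerivAt_integral_of_continuous hg.continuous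
  rw [contDiff_infty_iff_deriv]
  exact ⟨fun s => (h s).differentiableAt, by rwa [funext fun s => (h s).deriv]⟩

/-- A smooth increasing function on the unit interval with total variation above `m₀ < c` and slope
at most `c`, constant near the end points. -/
lemma exists_profile_ball {m₀ c : ℝ} (hc : 0 < c) (hm : m₀ < c) :
    ∃ (f f' : ℝ → ℝ) (m s₀ s₁ : ℝ), m₀ < m ∧ 0 < s₀ ∧ s₁ < 1 ∧ ContDiff ℝ ∞ f ∧
      (∀ s, HasDerivAt f (f' s) s) ∧ (∀ s, 0 ≤ f' s ∧ f' s ≤ c) ∧ (∀ s ≤ s₀, f s = 0) ∧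
      (∀ s, s₁ ≤ s → f s = m) ∧ ∀ s, 0 ≤ s → 0 ≤ f s := by
  obtain ⟨ρ, hρ1, hρ2⟩ : ∃ ρ, max (m₀ / c) 0 < ρ ∧ ρ < 1 :=
    exists_between (max_lt ((div_lt_one hc).2 hm) one_pos)
  have hρ0 : 0 < ρ := (le_max_right _ _).trans_lt hρ1
  have hρm : m₀ < ρ * c := (div_lt_iff₀ hc).1 ((le_max_left _ _).trans_lt hρ1)
  let χ : ContDiffBump (1 / 2 : ℝ) := ⟨ρ / 2, (1 + ρ) / 4, by linarith, by linarith⟩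
  have hχc : Continuous χ := χ.continuous
  have hzero : ∀ s, s ≤ (1 - ρ) / 4 ∨ (3 + ρ) / 4 ≤ s → χ s = 0 := fun s hs => by
    apply χ.zero_of_le_dist
    rw [Real.dist_eq, le_abs]
    change (1 + ρ) / 4 ≤ _ ∨ (1 + ρ) / 4 ≤ _
    rcases hs with h | h
    · right; linarith
    · left; linarith
  have hint : ∀ a b : ℝ, IntervalIntegrable (fun u => c * χ u) volume a b := fun a b => by
    apply Continuous.intervalIntegrable; fun_prop
  have hconst : ∀ a b : ℝ, (∀ s ∈ uIcc a b, χ s = 0) → ∫ u in a..b, c * χ u = 0 := by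
    intro a b h
    rw [intervalIntegral.integral_congr (g := fun _ => 0) fun s hs => by simp [h s hs]]
    simp
  refine ⟨fun s => ∫ u in (0 : ℝ)..s, c * χ u, fun s => c * χ s, ∫ u in (0 : ℝ)..1, c * χ u,
    (1 - ρ) / 4, (3 + ρ) / 4, ?_, by linarith, by linarith, contDiff_integral ?_, ?_, ?_, ?_, ?_, ?_⟩
  · have h1 : ∫ u in ((1 - ρ) / 2)..((1 + ρ) / 2), c ≤
        ∫ u in ((1 - ρ) / 2)..((1 + ρ) / 2), c * χ u := by
      apply intervalIntegral.integral_mono_on (by linarith) intervalIntegrable_const (hint _ _)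
      intro u hu
      rw [χ.one_of_mem_closedBall, mul_one]
      rw [Metric.mem_closedBall, Real.dist_eq, abs_le]
      change -(ρ / 2) ≤ _ ∧ _ ≤ ρ / 2
      constructor <;> linarith [hu.1, hu.2]
    have h2 : ∫ u in ((1 - ρ) / 2)..((1 + ρ) / 2), c * χ u ≤ ∫ u in (0 : ℝ)..1, c * χ u := by
      apply intervalIntegral.integral_mono_interval (by linarith) (by linarith) (by linarith)
      · exact Eventually.of_forall fun u => mul_nonneg hc.le χ.nonneg
      · exact hint _ _
    rw [intervalIntegral.integral_const, smul_eq_mul] at h1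
    nlinarith
  · exact contDiff_const.mul χ.contDiff
  · exact hasDerivAt_integral_of_continuous (by fun_prop)
  · exact fun s => ⟨mul_nonneg hc.le χ.nonneg, mul_le_of_le_one_right hc.le χ.le_one⟩
  · intro s hs
    refine hconst 0 s fun u hu => hzero u (Or.inl ?_)
    exact (mem_uIcc.1 hu).elim (fun h => by linarith [h.2]) fun h => by linarith [h.2]
  · intro s hs
    have := hconst 1 s fun u hu => hzero u (Or.inr ?_)
    · beta_reduce
      rw [← intervalIntegral.integral_add_adjacent_intervals (hint 0 1) (hint 1 s), this, add_zero]
    · exact (mem_uIcc.1 hu).elim (fun h => by linarith [h.1]) fun h => by linarith [h.1]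
  · exact fun s hs => intervalIntegral.integral_nonneg hs fun u _ => mul_nonneg hc.le χ.nonneg

/-- A smooth function which is constant to the left of `m₀`, and grows with slope one to the right
of `m`. -/
lemma exists_profile_outer {m₀ m : ℝ} (h0 : 0 < m₀) (hm : m₀ < m) :
    ∃ (F F' : ℝ → ℝ) (C : ℝ), ContDiff ℝ ∞ F ∧ (∀ s, HasDerivAt F (F' s) s) ∧
      (∀ s, 0 ≤ s → s ≤ m₀ → F s = m ∧ F' s = 0) ∧ (∀ s, m ≤ s → F s = s + C) ∧
      ∀ s, 0 ≤ s → m ≤ F s ∧ F' s * s ≤ F s := by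
  let χ : ContDiffBump (0 : ℝ) := ⟨m₀, m, h0, hm⟩
  have hχc : Continuous χ := χ.continuous
  have hint : ∀ a b : ℝ, IntervalIntegrable (fun u => 1 - χ u) volume a b := fun a b => by
    apply Continuous.intervalIntegrable; fun_prop
  set F : ℝ → ℝ := fun s => m + ∫ u in (0 : ℝ)..s, (1 - χ u) with hF
  have hFm : ∀ s, 0 ≤ s → m ≤ F s := fun s hs => by
    have : 0 ≤ ∫ u in (0 : ℝ)..s, (1 - χ u) :=
      intervalIntegral.integral_nonneg hs fun u _ => sub_nonneg.2 χ.le_one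
    simp only [hF]
    linarith
  have hone : ∀ s, 0 ≤ s → s ≤ m₀ → χ s = 1 := fun s h1 h2 => by
    apply χ.one_of_mem_closedBall
    rw [mem_closedBall_zero_iff, Real.norm_of_nonneg h1]
    exact h2
  have hzero : ∀ s, m ≤ s → χ s = 0 := fun s h => by
    apply χ.zero_of_le_dist
    rw [dist_zero_right, Real.norm_of_nonneg (by linarith)]
    exact h
  have hout : ∀ s, m ≤ s → F s = s + (F m - m) := by
    intro s hs
    have h1 : ∫ u in m..s, (1 - χ u) = s - m := by
      rw [intervalIntegral.integral_congr (g := fun _ => (1 : ℝ)) fun u hu => ?_]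
      · simp
      · rw [uIcc_of_le hs] at hu
        simp [hzero u hu.1]
    simp only [hF]
    rw [← intervalIntegral.integral_add_adjacent_intervals (hint 0 m) (hint m s), h1]
    ring
  refine ⟨F, fun s => 1 - χ s, F m - m, contDiff_const.add (contDiff_integral ?_), fun s =>
    (hasDerivAt_integral_of_continuous (by fun_prop) s).const_add m, ?_, hout, ?_⟩
  · exact contDiff_const.sub χ.contDiff
  · intro s h1 h2
    refine ⟨?_, by simp [hone s h1 h2]⟩
    simp only [hF]
    rw [intervalIntegral.integral_congr (g := fun _ => (0 : ℝ)) fun u hu => ?_]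
    · simp
    · rw [uIcc_of_le h1] at hu
      simp [hone u hu.1 (hu.2.trans h2)]
  · intro s hs
    refine ⟨hFm s hs, ?_⟩
    have h1 : s ≤ F s := by
      rcases le_or_gt s m with h | h
      · exact h.trans (hFm s hs)
      · rw [hout s h.le]
        linarith [hFm m (by linarith)]
    exact (mul_le_of_le_one_left hs (by linarith [χ.nonneg' s])).trans h1

end Profile

section Transfer
open Set MeasureTheory Filter Topology

variable {X : Type*} [NormedAddCommGroup X] [NormedSpace ℝ X] [FiniteDimensional ℝ X]

lemma exists_equiv_fderiv {ψ : X → X} (hψ : ContDiff ℝ ∞ ψ) {z : X}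
    (hinj : Function.Injective (fderiv ℝ ψ z)) :
    ∃ A : X ≃L[ℝ] X, HasFDerivAt ψ (A : X →L[ℝ] X) z := by
  let A : X ≃L[ℝ] X := (LinearEquiv.ofInjectiveEndo (fderiv ℝ ψ z : X →ₗ[ℝ] X)
    hinj).toContinuousLinearEquiv
  refine ⟨A, ?_⟩
  have : (A : X →L[ℝ] X) = fderiv ℝ ψ z := by ext; rfl
  rw [this]
  exact (hψ.differentiable (by simp) z).hasFDerivAt

lemma image_mem_nhds_of_injective_fderiv {ψ : X → X} (hψ : ContDiff ℝ ∞ ψ) {z : X}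
    (hinj : Function.Injective (fderiv ℝ ψ z)) {s : Set X} (hs : s ∈ 𝓝 z) :
    ψ '' s ∈ 𝓝 (ψ z) := by
  have := FiniteDimensional.complete ℝ X
  obtain ⟨A, hA⟩ := exists_equiv_fderiv hψ hinj
  have h := (hψ.contDiffAt (x := z)).hasStrictFDerivAt' hA (by simp)
  rw [← h.map_nhds_eq_of_equiv]
  exact image_mem_map hs

/-- Pushing forward a compactly supported function by an injective local diffeomorphism. -/
lemma exists_pushforward {ψ : X → X} (hψ : ContDiff ℝ ∞ ψ) (hψi : Function.Injective ψ)
    (hinj : ∀ z, Function.Injective (fderiv ℝ ψ z)) {q : X → ℝ} (hq : ContDiff ℝ ∞ q) {Z : Set X}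
    (hZ : IsCompact Z) (hqZ : ∀ z, z ∉ Z → q z = 0) :
    ∃ b : X → ℝ, ContDiff ℝ ∞ b ∧ (∀ z, b (ψ z) = q z) ∧ (∀ y, y ∉ ψ '' Z → b y = 0) ∧
      ∀ y, b y = 0 ∨ ∃ z ∈ Z, b y = q z := by
  have hcomp := FiniteDimensional.complete ℝ X
  set b : X → ℝ := Function.extend ψ q 0 with hb
  have hbψ : ∀ z, b (ψ z) = q z := fun z => hψi.extend_apply _ _ _
  have hb0 : ∀ y, y ∉ ψ '' Z → b y = 0 := by
    intro y hy
    by_cases h : ∃ z, ψ z = y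
    · obtain ⟨z, rfl⟩ := h
      rw [hbψ]
      exact hqZ z fun hz => hy ⟨z, hz, rfl⟩
    · exact Function.extend_apply' _ _ _ h
  refine ⟨b, ?_, hbψ, hb0, ?_⟩
  · rw [contDiff_iff_contDiffAt]
    intro y
    by_cases hy : y ∈ ψ '' Z
    · obtain ⟨z, -, rfl⟩ := hy
      obtain ⟨A, hA⟩ := exists_equiv_fderiv hψ (hinj z)
      have hz := hψ.contDiffAt (x := z)
      have h1 := hz.to_localInverse hA (by simp)
      have h2 := (hz.hasStrictFDerivAt' hA (by simp)).eventually_right_inverse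
      refine (hq.contDiffAt.comp (ψ z) h1).congr_of_eventuallyEq ?_
      filter_upwards [h2] with y hy
      rw [Function.comp_apply, ← hbψ]
      exact congrArg b hy.symm
    · have hcl : IsClosed (ψ '' Z) := (hZ.image hψ.continuous).isClosed
      refine (contDiffAt_const (c := (0 : ℝ))).congr_of_eventuallyEq ?_
      filter_upwards [hcl.isOpen_compl.mem_nhds hy] with y hy
      exact hb0 y hy
  · intro y
    by_cases hy : y ∈ ψ '' Z
    · obtain ⟨z, hz, rfl⟩ := hy
      exact Or.inr ⟨z, hz, hbψ z⟩
    · exact Or.inl (hb0 y hy)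

variable {V : Type*} [NormedAddCommGroup V] [InnerProductSpace ℝ V] [CompleteSpace V]

lemma gradient_sub_eq {f : V → ℝ} (x y : V) :
    ‖gradient f x - gradient f y‖ = ‖fderiv ℝ f x - fderiv ℝ f y‖ := by
  rw [gradient, gradient, ← map_sub, LinearIsometryEquiv.norm_map]

/-- Bounds for compactly supported smooth functions. -/
lemma exists_bound_of_hasCompactSupport {k : V → ℝ} (hk : ContDiff ℝ ∞ k)
    (hc : HasCompactSupport k) :
    ∃ M, 0 ≤ M ∧ (∀ z, |k z| ≤ M) ∧ (∀ z, ‖gradient k z‖ ≤ M) ∧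
      ∀ z w, ‖gradient k z - gradient k w‖ ≤ M * ‖z - w‖ := by
  obtain ⟨M₁, h1⟩ := hc.exists_bound_of_continuous hk.continuous
  obtain ⟨M₂, h2⟩ := (hc.fderiv (𝕜 := ℝ)).exists_bound_of_continuous
    (hk.continuous_fderiv (by simp))
  obtain ⟨M₃, h3⟩ := ContDiff.lipschitzWith_of_hasCompactSupport (𝕂 := ℝ) (n := 1)
    (hc.fderiv (𝕜 := ℝ)) (hk.fderiv_right (m := 1) (by norm_cast)) (by simp)
  refine ⟨max M₁ (max M₂ M₃), ?_, fun z => (h1 z).trans (le_max_left _ _), fun z => ?_,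
    fun z w => ?_⟩
  · exact (M₃.2.trans (le_max_right _ _)).trans (le_max_right _ _)
  · rw [gradient, LinearIsometryEquiv.norm_map]
    exact (h2 z).trans ((le_max_left _ _).trans (le_max_right _ _))
  · rw [gradient_sub_eq, ← dist_eq_norm, ← dist_eq_norm]
    refine (h3.dist_le_mul z w).trans ?_
    gcongr
    exact (le_max_right _ _).trans (le_max_right _ _)

/-- First order Taylor expansion of a function with Lipschitz gradient. -/
lemma abs_taylor_le {H : V → ℝ} {G : V → V} {L : ℝ} (hL : 0 ≤ L)
    (hG : ∀ z, HasGradientAt H (G z) z) (hGL : ∀ z w, ‖G z - G w‖ ≤ L * ‖z - w‖) (z w : V) :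
    |H (z + w) - H z - ⟪G z, w⟫| ≤ L * ‖w‖ ^ 2 := by
  have hball : Convex ℝ (Metric.closedBall z ‖w‖) := convex_closedBall _ _
  have h := hball.norm_image_sub_le_of_norm_hasFDerivWithin_le' (f := H) (𝕜 := ℝ)
    (f' := fun x => InnerProductSpace.toDual ℝ V (G x))
    (φ := InnerProductSpace.toDual ℝ V (G z)) (C := L * ‖w‖) (x := z) (y := z + w)
    (fun x _ => (hG x).hasFDerivAt.hasFDerivWithinAt) (fun x hx => by
      rw [← map_sub, LinearIsometryEquiv.norm_map]
      refine (hGL x z).trans ?_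
      rw [Metric.mem_closedBall, dist_eq_norm] at hx
      gcongr) (by simp) (by simp)
  rw [add_sub_cancel_left, InnerProductSpace.toDual_apply_apply] at h
  rw [pow_two, ← mul_assoc]
  exact h

end Transfer

section Diag
open Set MeasureTheory Filter Topology

variable {ι : Type*} [Fintype ι]

/-- The diagonal operator with real entries `a`. -/
def diagOp (a : ι → ℝ) : EuclideanSpace ℂ ι →L[ℂ] EuclideanSpace ℂ ι :=
  LinearMap.toContinuousLinearMap
    { toFun := fun z => WithLp.toLp 2 fun j => (a j : ℂ) * z j
      map_add' := fun x y => by ext j; simp [mul_add]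
      map_smul' := fun c x => by ext j; simp [mul_left_comm] }

@[simp] lemma diagOp_apply (a : ι → ℝ) (z : EuclideanSpace ℂ ι) (j : ι) :
    diagOp a z j = a j * z j := rfl

lemma inner_diagOp (a : ι → ℝ) (z w : EuclideanSpace ℂ ι) :
    ⟪diagOp a z, w⟫ = ∑ j, a j * ⟪z j, w j⟫ := by
  rw [PiLp.inner_apply]
  refine Finset.sum_congr rfl fun j _ => ?_
  rw [diagOp_apply, ← Complex.real_smul, real_inner_smul_left]

lemma inner_diagOp_comm (a : ι → ℝ) (z w : EuclideanSpace ℂ ι) :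
    ⟪diagOp a z, w⟫ = ⟪diagOp a w, z⟫ := by
  simp_rw [inner_diagOp, real_inner_comm]

lemma inner_diagOp_self (a : ι → ℝ) (z : EuclideanSpace ℂ ι) :
    ⟪diagOp a z, z⟫ = ∑ j, a j * ‖z j‖ ^ 2 := by
  simp_rw [inner_diagOp, real_inner_self_eq_norm_sq]

lemma inner_diagOp_self_nonneg {a : ι → ℝ} (ha : ∀ j, 0 ≤ a j) (z : EuclideanSpace ℂ ι) :
    0 ≤ ⟪diagOp a z, z⟫ := by
  rw [inner_diagOp_self]
  exact Finset.sum_nonneg fun j _ => mul_nonneg (ha j) (sq_nonneg _)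

lemma mul_norm_le_norm_smul_sub_diagOp {a : ι → ℝ} {δ x : ℝ} (hδ : 0 ≤ δ)
    (h : ∀ j, δ ≤ |x - a j|) (w : EuclideanSpace ℂ ι) :
    δ * ‖w‖ ≤ ‖x • w - diagOp a w‖ := by
  refine le_of_sq_le_sq ?_ (norm_nonneg _)
  rw [mul_pow, EuclideanSpace.norm_sq_eq, EuclideanSpace.norm_sq_eq, Finset.mul_sum]
  refine Finset.sum_le_sum fun j _ => ?_
  have : (x • w - diagOp a w) j = ((x - a j : ℝ) : ℂ) * w j := by simp [sub_mul]
  rw [this, norm_mul, mul_pow, Complex.norm_real, Real.norm_eq_abs]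
  gcongr
  exact h j

/-- The quadratic function `⟨A (z + w), z + w⟩` for diagonal `A`. -/
def quadFun (a : ι → ℝ) (w z : EuclideanSpace ℂ ι) : ℝ := ⟪diagOp a (z + w), z + w⟫

lemma contDiff_quadFun (a : ι → ℝ) (w : EuclideanSpace ℂ ι) : ContDiff ℝ ∞ (quadFun a w) := by
  have h : ContDiff ℝ ∞ fun z => diagOp a (z + w) :=
    ((diagOp a).restrictScalars ℝ).contDiff.comp (contDiff_id.add contDiff_const)
  exact h.inner ℝ (contDiff_id.add contDiff_const)

lemma hasGradientAt_quadFun (a : ι → ℝ) (w z : EuclideanSpace ℂ ι) :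
    HasGradientAt (quadFun a w) ((2 : ℝ) • diagOp a (z + w)) z := by
  have h1 : HasFDerivAt (fun z : EuclideanSpace ℂ ι => z + w)
      (ContinuousLinearMap.id ℝ (EuclideanSpace ℂ ι)) z := (hasFDerivAt_id z).add_const w
  have h2 : HasFDerivAt (fun z : EuclideanSpace ℂ ι => diagOp a (z + w))
      ((diagOp a).restrictScalars ℝ) z := by
    exact ((diagOp a).restrictScalars ℝ).hasFDerivAt.comp z h1
  have h3 := h2.inner ℝ h1
  rw [hasGradientAt_iff_hasFDerivAt]
  refine h3.congr_fderiv ?_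
  ext u
  change ⟪diagOp a (z + w), u⟫ + ⟪diagOp a u, z + w⟫ = ⟪(2 : ℝ) • diagOp a (z + w), u⟫
  rw [inner_diagOp_comm a u, real_inner_smul_left]
  ring

lemma exists_lower_bound_quadFun {a : ι → ℝ} (ha : ∀ j, 0 ≤ a j) {θ : ℝ} (hθ : 0 < θ)
    (w : EuclideanSpace ℂ ι) :
    ∃ C, ∀ z, (1 - θ) * (∑ j, a j * ‖z j‖ ^ 2) - C ≤ quadFun a w z := by
  refine ⟨(1 / θ) * ∑ j, a j * ‖w j‖ ^ 2, fun z => ?_⟩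
  rw [quadFun, inner_diagOp_self, Finset.mul_sum, Finset.mul_sum, ← Finset.sum_sub_distrib]
  refine Finset.sum_le_sum fun j _ => ?_
  have h1 : ‖z j‖ - ‖w j‖ ≤ ‖z j + w j‖ := by
    have := norm_sub_le (z j + w j) (w j); rw [add_sub_cancel_right] at this; linarith
  have h2 : (1 - θ) * ‖z j‖ ^ 2 - 1 / θ * ‖w j‖ ^ 2 ≤ ‖z j + w j‖ ^ 2 := by
    have h3 : ‖w j‖ - ‖z j‖ ≤ ‖z j + w j‖ := by
      have := norm_sub_le (z j + w j) (z j); rw [add_sub_cancel_left] at this; linarith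
    have h4 : (‖z j‖ - ‖w j‖) ^ 2 ≤ ‖z j + w j‖ ^ 2 :=
      sq_le_sq' (by linarith) h1
    have h5 : 0 ≤ (θ * ‖z j‖ - ‖w j‖) ^ 2 / θ := by positivity
    have h6 : (θ * ‖z j‖ - ‖w j‖) ^ 2 / θ
        = θ * ‖z j‖ ^ 2 - 2 * ‖z j‖ * ‖w j‖ + 1 / θ * ‖w j‖ ^ 2 := by
      field_simp; ring
    nlinarith [sq_nonneg ‖w j‖]
  calc _ = a j * ((1 - θ) * ‖z j‖ ^ 2 - 1 / θ * ‖w j‖ ^ 2) := by ring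
    _ ≤ _ := mul_le_mul_of_nonneg_left h2 (ha j)

end Diag

section Dichotomy
open Set MeasureTheory Filter Topology

variable {ι : Type*} [Fintype ι]
variable {H : EuclideanSpace ℂ ι → ℝ} {G : EuclideanSpace ℂ ι → EuclideanSpace ℂ ι}

lemma inner_I_smul_I_smul (u v : EuclideanSpace ℂ ι) :
    ⟪Complex.I • u, Complex.I • v⟫ = ⟪u, v⟫ := by
  simp only [PiLp.inner_apply, PiLp.smul_apply, Complex.inner, smul_eq_mul]
  refine Finset.sum_congr rfl fun j _ => ?_
  simp [Complex.mul_re, Complex.mul_im]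

lemma inner_I_smul_left (u v : EuclideanSpace ℂ ι) :
    ⟪Complex.I • u, v⟫ = -⟪u, Complex.I • v⟫ := by
  rw [← inner_I_smul_I_smul, smul_smul, Complex.I_mul_I, neg_one_smul, inner_neg_left]

lemma injective_of_symplectic
    {A : EuclideanSpace ℂ ι →L[ℝ] EuclideanSpace ℂ ι}
    (hA : ∀ u v, ⟪Complex.I • A u, A v⟫ = ⟪Complex.I • u, v⟫) : Function.Injective A := by
  rw [injective_iff_map_eq_zero]
  intro u hu
  have h := hA u (Complex.I • u)
  rw [hu, smul_zero, inner_zero_left, inner_I_smul_I_smul, eq_comm, inner_self_eq_zero] at h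
  exact h

/-- Periodic orbits meeting the image of the ball consist of critical points. -/
lemma eq_zero_of_orbit_meets_ball {ψ : EuclideanSpace ℂ ι → EuclideanSpace ℂ ι}
    (hψ : ContDiff ℝ ∞ ψ) (hψi : Function.Injective ψ)
    (hsymp : ∀ z u v, ⟪Complex.I • fderiv ℝ ψ z u, fderiv ℝ ψ z v⟫ = ⟪Complex.I • u, v⟫)
    (hG : ∀ z, HasGradientAt H (G z) z) {L : ℝ} (hL : 0 ≤ L)
    (hGL : ∀ z w, ‖G z - G w‖ ≤ L * ‖z - w‖) {f f' : ℝ → ℝ} (hf : ∀ s, HasDerivAt f (f' s) s)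
    (hf0 : ∀ s, 0 ≤ f' s) (hfπ : ∀ s, f' s < Real.pi)
    (hH : ∀ z, ‖z‖ < 1 → H (ψ z) = f (‖z‖ ^ 2)) {y : ℝ → EuclideanSpace ℂ ι}
    (hyc : Continuous y) (hy : ∀ t ∈ Icc (0 : ℝ) 1, HasDerivAt y (Complex.I • G (y t)) t)
    (hy01 : y 0 = y 1) {t₀ : ℝ} (ht₀ : t₀ ∈ Icc (0 : ℝ) 1) {ζ : EuclideanSpace ℂ ι}
    (hζ : ‖ζ‖ < 1) (hyζ : y t₀ = ψ ζ) : ∀ t ∈ Icc (0 : ℝ) 1, G (y t) = 0 := by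
  have hdψ : ∀ z, HasFDerivAt ψ (fderiv ℝ ψ z) z := fun z =>
    (hψ.differentiable (by simp) z).hasFDerivAt
  have hgrad : ∀ z, ‖z‖ < 1 → ∀ u, ⟪G (ψ z), fderiv ℝ ψ z u⟫ = 2 * f' (‖z‖ ^ 2) * ⟪z, u⟫ := by
    intro z hz u
    have h1 := (hG (ψ z)).hasFDerivAt.comp z (hdψ z)
    have h2 : HasFDerivAt (fun z => f (‖z‖ ^ 2)) (f' (‖z‖ ^ 2) • (2 : ℕ) • innerSL ℝ z) z := by
      have := (hf (‖z‖ ^ 2)).comp_hasFDerivAt z (hasStrictFDerivAt_norm_sq z).hasFDerivAt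
      exact this
    have h3 : H ∘ ψ =ᶠ[𝓝 z] fun z => f (‖z‖ ^ 2) := by
      filter_upwards [Metric.isOpen_ball.mem_nhds
        (show z ∈ Metric.ball (0 : EuclideanSpace ℂ ι) 1 by simpa using hz)] with x hx
      exact hH x (by simpa using hx)
    have h4 := h1.unique (h2.congr_of_eventuallyEq h3)
    have h5 := DFunLike.congr_fun h4 u
    simp [InnerProductSpace.toDual_apply_apply] at h5
    rw [h5]; ring
  have hX : ∀ z, ‖z‖ < 1 →
      fderiv ℝ ψ z ((2 * f' (‖z‖ ^ 2)) • Complex.I • z) = Complex.I • G (ψ z) := by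
    intro z hz
    set A := fderiv ℝ ψ z with hA
    have hinj := injective_of_symplectic (hsymp z)
    have hsurj : Function.Surjective A :=
      (LinearMap.injective_iff_surjective (f := A.toLinearMap)).1 hinj
    set v := A ((2 * f' (‖z‖ ^ 2)) • Complex.I • z) with hv
    have h1 : Complex.I • v = - G (ψ z) := by
      rw [← sub_eq_zero, ← inner_self_eq_zero (𝕜 := ℝ), sub_neg_eq_add]
      obtain ⟨u, hu⟩ := hsurj (Complex.I • v + G (ψ z))
      rw [inner_add_left, ← hu, hgrad z hz, hv, hsymp, smul_comm,
        smul_smul Complex.I, Complex.I_mul_I, real_inner_smul_left, neg_one_smul, inner_neg_left]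
      ring
    have h2 : Complex.I • Complex.I • v = - (Complex.I • G (ψ z)) := by rw [h1, smul_neg]
    rw [smul_smul, Complex.I_mul_I, neg_one_smul] at h2
    exact neg_injective h2
  set κ : ℝ := 2 * f' (‖ζ‖ ^ 2) with hκ
  let x : ℝ → EuclideanSpace ℂ ι := fun t => Complex.exp ((κ * (t - t₀) : ℝ) * Complex.I) • ζ
  have hxn : ∀ t, ‖x t‖ = ‖ζ‖ := fun t => by
    simp only [x]; rw [norm_smul, Complex.norm_exp_ofReal_mul_I, one_mul]
  have hx0 : x t₀ = ζ := by simp [x]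
  have hxd : ∀ t, HasDerivAt x (κ • Complex.I • x t) t := fun t => by
    have h1 : HasDerivAt (fun t : ℝ => ((κ * (t - t₀) : ℝ) : ℂ) * Complex.I) (κ * Complex.I) t := by
      have h0 : HasDerivAt (fun t : ℝ => κ * (t - t₀)) κ t := by
        simpa using ((hasDerivAt_id t).sub_const t₀).const_mul κ
      exact h0.ofReal_comp.mul_const _
    have h2 := h1.cexp.smul_const ζ
    refine h2.congr_deriv ?_
    simp only [x]
    rw [← Complex.coe_smul, smul_smul, smul_smul]
    congr 1; ring
  let Y : ℝ → EuclideanSpace ℂ ι := fun t => ψ (x t)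
  have hYd : ∀ t, HasDerivAt Y (Complex.I • G (Y t)) t := fun t => by
    have h1 := (hdψ (x t)).comp_hasDerivAt t (hxd t)
    refine h1.congr_deriv ?_
    rw [← hX (x t) (by rw [hxn]; exact hζ), hxn]
  have hYc : Continuous Y := continuous_iff_continuousAt.2 fun t => (hYd t).continuousAt
  have hLip : LipschitzWith ⟨L, hL⟩ fun z => Complex.I • G z :=
    LipschitzWith.of_dist_le_mul fun z w => by
      rw [dist_eq_norm, dist_eq_norm, ← smul_sub, norm_smul, Complex.norm_I, one_mul]
      exact hGL z w
  have heq0 : y t₀ = Y t₀ := by simp only [Y]; rw [hx0, hyζ]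
  have hright : EqOn y Y (Icc t₀ 1) :=
    ODE_solution_unique_of_mem_Icc_right (v := fun _ z => Complex.I • G z) (s := fun _ => univ)
      (fun t _ => hLip.lipschitzOnWith) hyc.continuousOn
      (fun t ht => (hy t ⟨ht₀.1.trans ht.1, ht.2.le⟩).hasDerivWithinAt) (fun _ _ => mem_univ _)
      hYc.continuousOn (fun t _ => (hYd t).hasDerivWithinAt) (fun _ _ => mem_univ _) heq0
  have hleft : EqOn y Y (Icc 0 t₀) :=
    ODE_solution_unique_of_mem_Icc_left (v := fun _ z => Complex.I • G z) (s := fun _ => univ)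
      (fun t _ => hLip.lipschitzOnWith) hyc.continuousOn
      (fun t ht => (hy t ⟨ht.1.le, ht.2.trans ht₀.2⟩).hasDerivWithinAt) (fun _ _ => mem_univ _)
      hYc.continuousOn (fun t _ => (hYd t).hasDerivWithinAt) (fun _ _ => mem_univ _) heq0
  have heq : ∀ t ∈ Icc (0 : ℝ) 1, y t = Y t := fun t ht => by
    rcases le_total t t₀ with h | h
    · exact hleft ⟨ht.1, h⟩
    · exact hright ⟨h, ht.2⟩
  have hper : x 0 = x 1 := hψi (by
    rw [heq 0 (by simp), heq 1 (by simp)] at hy01; exact hy01)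
  have hζ0 : κ • ζ = 0 := by
    by_contra hne
    have hζne : ζ ≠ 0 := fun h => hne (by rw [h, smul_zero])
    have hκne : κ ≠ 0 := fun h => hne (by rw [h, zero_smul])
    have h1 := smul_left_injective ℂ hζne hper
    rw [Complex.exp_eq_exp_iff_exists_int] at h1
    obtain ⟨N, hN⟩ := h1
    have h2 : (κ * (0 - t₀) : ℝ) = κ * (1 - t₀) + N * (2 * Real.pi) := by
      have := congrArg Complex.im hN
      simpa using this
    have h3 : κ = (-N : ℤ) * (2 * Real.pi) := by push_cast; linarith
    have h4 : 0 < κ := lt_of_le_of_ne (by rw [hκ]; linarith [hf0 (‖ζ‖ ^ 2)]) hκne.symm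
    have h5 : κ < 2 * Real.pi := by rw [hκ]; linarith [hfπ (‖ζ‖ ^ 2)]
    have hpi := Real.pi_pos
    have h6 : (0 : ℝ) < (-N : ℤ) := by
      by_contra hh; push Not at hh; nlinarith
    have h7 : ((-N : ℤ) : ℝ) < 1 := by
      by_contra hh; push Not at hh; nlinarith
    have h8 : (0 : ℤ) < -N := by exact_mod_cast h6
    have h9 : (-N : ℤ) < 1 := by exact_mod_cast h7
    omega
  intro t ht
  have h1 : Complex.I • G (y t) = 0 := by
    rw [heq t ht]
    simp only [Y]
    rw [← hX (x t) (by rw [hxn]; exact hζ), hxn]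
    simp only [x]
    rw [← hκ, smul_comm κ, smul_comm κ, hζ0, smul_zero, smul_zero, map_zero]
  exact (smul_eq_zero.1 h1).resolve_left Complex.I_ne_zero

/-- Periodic orbits of a radial function of a quadratic function have action bounded above by the
integral of `s F'(s) - F(s)`. -/
lemma action_nonpos_of_radial {a : ι → ℝ} (ha : ∀ j, 0 ≤ a j) {w : EuclideanSpace ℂ ι}
    (hG : Continuous G) {F F' : ℝ → ℝ}
    (hF : ∀ s, 0 ≤ s → F' s * s ≤ F s) {y : ℝ → EuclideanSpace ℂ ι}
    (hyc : Continuous y) (hy : ∀ t ∈ Icc (0 : ℝ) 1, HasDerivAt y (Complex.I • G (y t)) t)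
    (hy01 : y 0 = y 1) (hH : Continuous H)
    (hGy : ∀ t ∈ Icc (0 : ℝ) 1,
      G (y t) = F' (quadFun a w (y t)) • (2 : ℝ) • diagOp a (y t + w))
    (hHy : ∀ t ∈ Icc (0 : ℝ) 1, H (y t) = F (quadFun a w (y t))) :
    ∫ t in (0 : ℝ)..1, (1 / 2 * ⟪G (y t), y t⟫ - H (y t)) ≤ 0 := by
  have h0 : ∫ t in (0 : ℝ)..1, ⟪G (y t), w⟫ = 0 := by
    have h1 : ∀ t ∈ uIcc (0 : ℝ) 1, HasDerivAt (fun t => ⟪y t, Complex.I • w⟫) ⟪G (y t), w⟫ t := by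
      intro t ht
      rw [uIcc_of_le zero_le_one] at ht
      have := (hy t ht).inner ℝ (hasDerivAt_const t (Complex.I • w))
      simpa [inner_I_smul_I_smul] using this
    rw [intervalIntegral.integral_eq_sub_of_hasDerivAt h1
      (by apply Continuous.intervalIntegrable; fun_prop), hy01, sub_self]
  have h2 : ∫ t in (0 : ℝ)..1, (1 / 2 * ⟪G (y t), y t⟫ - H (y t)) =
      ∫ t in (0 : ℝ)..1, (1 / 2 * ⟪G (y t), y t + w⟫ - H (y t)) := by
    have : ∀ t, (1 / 2 * ⟪G (y t), y t + w⟫ - H (y t)) =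
        (1 / 2 * ⟪G (y t), y t⟫ - H (y t)) + 1 / 2 * ⟪G (y t), w⟫ := fun t => by
      rw [inner_add_right]; ring
    simp_rw [this]
    rw [intervalIntegral.integral_add, intervalIntegral.integral_const_mul, h0]
    · ring
    · apply Continuous.intervalIntegrable; fun_prop
    · apply Continuous.intervalIntegrable; fun_prop
  rw [h2, ← neg_nonneg, ← intervalIntegral.integral_neg]
  refine intervalIntegral.integral_nonneg zero_le_one fun t ht => ?_
  rw [hGy t ht, hHy t ht, real_inner_smul_left, real_inner_smul_left]
  have h3 := hF (quadFun a w (y t)) (inner_diagOp_self_nonneg ha _)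
  change 0 ≤ -(1 / 2 * (F' (quadFun a w (y t)) * (2 * quadFun a w (y t))) - F (quadFun a w (y t)))
  linarith

end Dichotomy

section Nonsqueezing
open Set MeasureTheory Filter Topology

variable {ι : Type*} [Fintype ι]

/-- A quadratic function has coercive growth when its coefficients are bounded below. -/
lemma norm_sq_le_quadFun {a : ι → ℝ} {μ : ℝ} (ha : ∀ j, μ ≤ a j) (w z : EuclideanSpace ℂ ι) :
    μ * ‖z + w‖ ^ 2 ≤ quadFun a w z := by
  rw [quadFun, inner_diagOp_self, EuclideanSpace.norm_sq_eq, Finset.mul_sum]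
  exact Finset.sum_le_sum fun j _ => mul_le_mul_of_nonneg_right (ha j) (sq_nonneg _)

lemma le_abs_two_pi_mul_sub {ε : ℝ} {δ : ℝ} (h1 : δ ≤ 2 * Real.pi * ε)
    (h2 : δ ≤ 2 * Real.pi * (1 - ε)) (k : ℤ) :
    δ ≤ |2 * Real.pi * k - 2 * (Real.pi * ε)| := by
  have hpi := Real.pi_pos
  rw [le_abs]
  rcases le_or_gt k 0 with hk | hk
  · right
    have : (k : ℝ) ≤ 0 := by exact_mod_cast hk
    nlinarith
  · left
    have : (1 : ℝ) ≤ k := by exact_mod_cast hk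
    nlinarith

lemma mul_norm_sq_add_le [DecidableEq ι] {b : ι → ℝ} {δ x : ℝ} (i₀ : ι) (h : ∀ j, δ ≤ b j)
    (h₀ : δ + x ≤ b i₀) (z : EuclideanSpace ℂ ι) :
    δ * ‖z‖ ^ 2 + x * ‖z i₀‖ ^ 2 ≤ ∑ j, b j * ‖z j‖ ^ 2 := by
  rw [EuclideanSpace.norm_sq_eq, Finset.mul_sum, ← Finset.add_sum_erase _ _ (Finset.mem_univ i₀),
    ← Finset.add_sum_erase (a := i₀) _ (fun j => b j * ‖z j‖ ^ 2) (Finset.mem_univ i₀)]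
  have h1 : ∑ j ∈ Finset.univ.erase i₀, δ * ‖z j‖ ^ 2 ≤
      ∑ j ∈ Finset.univ.erase i₀, b j * ‖z j‖ ^ 2 :=
    Finset.sum_le_sum fun j _ => mul_le_mul_of_nonneg_right (h j) (sq_nonneg _)
  have h2 := mul_le_mul_of_nonneg_right h₀ (sq_nonneg ‖z i₀‖)
  linarith

/-- The function `F ∘ p` for a quadratic function `p` is a compactly supported perturbation of
`p + C` when `F s = s + C` for large `s`. -/
lemma hasCompactSupport_comp_quadFun_sub {a : ι → ℝ} {μ : ℝ} (hμ : 0 < μ) (ha : ∀ j, μ ≤ a j)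
    (w : EuclideanSpace ℂ ι) {F : ℝ → ℝ} {m C : ℝ} (hF : ∀ s, m ≤ s → F s = s + C) :
    HasCompactSupport fun z => F (quadFun a w z) - quadFun a w z - C := by
  refine HasCompactSupport.intro (isCompact_closedBall (-w) √(m / μ)) fun z hz => ?_
  rw [Metric.mem_closedBall, dist_eq_norm, sub_neg_eq_add, not_le] at hz
  have h1 : m ≤ quadFun a w z := by
    refine le_trans ?_ (norm_sq_le_quadFun ha w z)
    have h2 : m / μ ≤ ‖z + w‖ ^ 2 := by
      rcases le_or_gt 0 (m / μ) with h | h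
      · rw [← Real.sq_sqrt h]
        gcongr
      · exact h.le.trans (sq_nonneg _)
    rwa [div_le_iff₀' hμ] at h2
  rw [hF _ h1]
  ring

set_option maxHeartbeats 1000000 in
/-- The symplectic nonsqueezing theorem for injective smooth symplectic maps of `ℂⁿ`. -/
theorem nonsqueezing_of_symplectic [DecidableEq ι] (i₀ : ι)
    {ψ : EuclideanSpace ℂ ι → EuclideanSpace ℂ ι}
    (hψ : ContDiff ℝ ∞ ψ) (hψi : Function.Injective ψ) (hψ0 : ψ 0 = 0)
    (hsymp : ∀ z u v, ⟪Complex.I • fderiv ℝ ψ z u, fderiv ℝ ψ z v⟫ = ⟪Complex.I • u, v⟫)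
    {w₀ : ℂ} {r : ℝ} (hr0 : 0 < r) (hr1 : r < 1)
    (hr : ∀ z, ‖z‖ ≤ 1 → ‖ψ z i₀ + w₀‖ ≤ r) : False := by
  have hpi := Real.pi_pos
  have hinj : ∀ z, Function.Injective (fderiv ℝ ψ z) := fun z => injective_of_symplectic (hsymp z)
  -- choice of the quadratic form
  obtain ⟨R, hR0, hR⟩ : ∃ R, 0 < R ∧ ∀ z : EuclideanSpace ℂ ι, ‖z‖ ≤ 1 → ‖ψ z‖ ≤ R := by
    obtain ⟨R, hR⟩ := (isCompact_closedBall (0 : EuclideanSpace ℂ ι) 1).exists_bound_of_continuousOn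
      hψ.continuous.continuousOn
    exact ⟨max R 1, by positivity, fun z hz => (hR z (by simpa using hz)).trans (le_max_left _ _)⟩
  obtain ⟨ε, hε0, hε1, hεr⟩ : ∃ ε : ℝ, 0 < ε ∧ ε < 1 ∧ (1 + ε) * r ^ 2 < 1 := by
    have : r ^ 2 < 1 := by nlinarith
    exact ⟨(1 - r ^ 2) / 2, by linarith, by nlinarith, by nlinarith [sq_nonneg r]⟩
  obtain ⟨μ, hμ0, hμπ, hμR⟩ : ∃ μ, 0 < μ ∧ μ < Real.pi ∧
      Real.pi * (1 + ε) * r ^ 2 + μ * R ^ 2 < Real.pi := by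
    have h1 : 0 < Real.pi * (1 - (1 + ε) * r ^ 2) := by
      have := sub_pos.2 hεr; positivity
    have h2 : 0 < R ^ 2 := by positivity
    refine ⟨min (Real.pi / 2) (Real.pi * (1 - (1 + ε) * r ^ 2) / (2 * R ^ 2)),
      lt_min (by positivity) (by positivity), (min_le_left _ _).trans_lt (by linarith), ?_⟩
    have h3 := mul_le_mul_of_nonneg_right
      (min_le_right (Real.pi / 2) (Real.pi * (1 - (1 + ε) * r ^ 2) / (2 * R ^ 2))) h2.le
    have h4 : Real.pi * (1 - (1 + ε) * r ^ 2) / (2 * R ^ 2) * R ^ 2 =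
        Real.pi * (1 - (1 + ε) * r ^ 2) / 2 := by field_simp
    rw [h4] at h3
    nlinarith
  set a : ι → ℝ := fun j => if j = i₀ then Real.pi * (1 + ε) else μ with ha
  have haμ : ∀ j, μ ≤ a j := fun j => by
    simp only [ha]; split_ifs <;> nlinarith
  have ha0 : ∀ j, 0 ≤ a j := fun j => hμ0.le.trans (haμ j)
  set w : EuclideanSpace ℂ ι := EuclideanSpace.single i₀ w₀ with hw
  set p := quadFun a w with hp
  set m₀ := Real.pi * (1 + ε) * r ^ 2 + μ * R ^ 2 with hm₀
  have hm₀0 : 0 < m₀ := by positivity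
  have hp0 : ∀ z, 0 ≤ p z := fun z => inner_diagOp_self_nonneg ha0 _
  have hpψ : ∀ z, ‖z‖ ≤ 1 → p (ψ z) ≤ m₀ := by
    intro z hz
    rw [hp, quadFun, inner_diagOp_self, ← Finset.add_sum_erase _ _ (Finset.mem_univ i₀)]
    refine add_le_add ?_ ?_
    · have : (ψ z + w) i₀ = ψ z i₀ + w₀ := by simp [hw]
      rw [this]
      simp only [ha, if_true]
      have := hr z hz
      gcongr
    · calc ∑ j ∈ Finset.univ.erase i₀, a j * ‖(ψ z + w) j‖ ^ 2
          = ∑ j ∈ Finset.univ.erase i₀, μ * ‖ψ z j‖ ^ 2 := by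
            refine Finset.sum_congr rfl fun j hj => ?_
            have hj : j ≠ i₀ := Finset.ne_of_mem_erase hj
            simp [ha, hw, hj]
        _ ≤ ∑ j, μ * ‖ψ z j‖ ^ 2 := Finset.sum_le_sum_of_subset_of_nonneg
            (Finset.erase_subset _ _) fun _ _ _ => by positivity
        _ = μ * ‖ψ z‖ ^ 2 := by rw [EuclideanSpace.norm_sq_eq, Finset.mul_sum]
        _ ≤ μ * R ^ 2 := by have := hR z hz; gcongr
  -- the profile functions
  obtain ⟨c, hmc, hcπ⟩ := exists_between hμR
  obtain ⟨f, f', m, s₀, s₁, hm₀m, hs₀, hs₁, hfs, hfd, hf', hf0, hf1, hfn⟩ :=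
    exists_profile_ball (hm₀0.trans hmc) hmc
  obtain ⟨F, F', C, hFs, hFd, hFm, hFC, hFF⟩ := exists_profile_outer hm₀0 hm₀m
  have hm0 : 0 < m := hm₀0.trans hm₀m
  have hρ1 : √(max s₁ 0) < 1 := by
    rw [Real.sqrt_lt' one_pos]; simpa using hs₁
  obtain ⟨b, hbs, hbψ, hb0, hbq⟩ := exists_pushforward hψ hψi hinj
    (q := fun z => m - f (‖z‖ ^ 2)) (contDiff_const.sub (hfs.comp (contDiff_norm_sq ℝ)))
    (isCompact_closedBall 0 √(max s₁ 0)) (fun z hz => by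
      rw [mem_closedBall_zero_iff, not_le] at hz
      rw [hf1 _ ((le_max_left _ _).trans (Real.lt_sq_of_sqrt_lt hz).le), sub_self])
  -- the Hamiltonian
  set H : EuclideanSpace ℂ ι → ℝ := fun z => F (p z) - b z with hHdef
  set k : EuclideanSpace ℂ ι → ℝ := fun z => (F (p z) - p z - C) - b z with hk
  have hps : ContDiff ℝ ∞ p := contDiff_quadFun a w
  have hks : ContDiff ℝ ∞ k := (((hFs.comp hps).sub hps).sub contDiff_const).sub hbs
  have hZ : IsCompact (ψ '' Metric.closedBall 0 √(max s₁ 0)) :=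
    (isCompact_closedBall _ _).image hψ.continuous
  have hkc : HasCompactSupport k :=
    (hasCompactSupport_comp_quadFun_sub hμ0 haμ w hFC).sub (HasCompactSupport.intro hZ hb0)
  obtain ⟨M, hM0, hkM, hkg, hkL⟩ := exists_bound_of_hasCompactSupport hks hkc
  set B := diagOp (fun j => 2 * a j) with hB
  have hB2 : ∀ z, B z = (2 : ℝ) • diagOp a z := fun z => by
    ext j; simp [hB, mul_assoc]
  set G : EuclideanSpace ℂ ι → EuclideanSpace ℂ ι := fun z => B (z + w) + gradient k z with hGdef
  have hpG : ∀ z, HasGradientAt p (B (z + w)) z := fun z => by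
    rw [hB2]; exact hasGradientAt_quadFun a w z
  have hHeq : H = fun z => p z + k z + C := by
    funext z; simp only [hHdef, hk]; ring
  have hG : ∀ z, HasGradientAt H (G z) z := fun z => by
    have h1 := (hpG z).hasFDerivAt.add
      ((hks.differentiable (by simp) z).hasGradientAt.hasFDerivAt)
    rw [← map_add] at h1
    rw [hHeq, hasGradientAt_iff_hasFDerivAt]
    exact h1.add_const C
  have hGB : ∀ z, G z - B z = B w + gradient k z := fun z => by
    simp only [hGdef, map_add]; abel
  set L := ‖B‖ + M + 1 with hL
  have hL0 : 0 < L := by positivity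
  have hGL : ∀ z z', ‖G z - G z'‖ ≤ L * ‖z - z'‖ := fun z z' => by
    have h1 : G z - G z' = B (z - z') + (gradient k z - gradient k z') := by
      simp only [hGdef, map_add, map_sub]; abel
    rw [h1]
    refine (norm_add_le _ _).trans ?_
    have h2 := B.le_opNorm (z - z')
    have h3 := hkL z z'
    rw [hL]
    nlinarith [norm_nonneg (z - z')]
  have hHs : ContDiff ℝ ∞ H := (hFs.comp hps).sub hbs
  have hGc : Continuous G := (LipschitzWith.of_dist_le_mul (K := ⟨L, hL0.le⟩) fun z w => by
    rw [dist_eq_norm, dist_eq_norm]; exact hGL z w).continuous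
  have hHψ : ∀ z, ‖z‖ ≤ 1 → H (ψ z) = f (‖z‖ ^ 2) := fun z hz => by
    simp only [hHdef]
    rw [(hFm _ (hp0 _) (hpψ z hz)).1, hbψ]
    ring
  have hH0 : ∀ z, 0 ≤ H z := fun z => by
    have h1 := (hFF (p z) (hp0 z)).1
    rcases hbq z with h | ⟨x, -, h⟩
    · simp only [hHdef, h]; linarith
    · simp only [hHdef, h]
      linarith [hfn (‖x‖ ^ 2) (sq_nonneg _)]
  obtain ⟨ρ, hρ0, hρ⟩ : ∃ ρ, 0 < ρ ∧ ∀ z, ‖z‖ ≤ ρ → H z = 0 := by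
    have h1 : {z : EuclideanSpace ℂ ι | ‖z‖ ≤ 1 ∧ ‖z‖ ^ 2 ≤ s₀} ∈ 𝓝 0 := by
      have h2 : ∀ᶠ z : EuclideanSpace ℂ ι in 𝓝 0, ‖z‖ < 1 :=
        continuous_norm.continuousAt.eventually_lt continuousAt_const (by simp)
      have h3 : ∀ᶠ z : EuclideanSpace ℂ ι in 𝓝 0, ‖z‖ ^ 2 < s₀ :=
        (continuous_norm.pow 2).continuousAt.eventually_lt continuousAt_const (by simpa using hs₀)
      filter_upwards [h2, h3] with z hz hz' using ⟨hz.le, hz'.le⟩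
    have h2 := image_mem_nhds_of_injective_fderiv hψ (hinj 0) h1
    rw [hψ0] at h2
    obtain ⟨ρ, hρ0, hρ⟩ := Metric.nhds_basis_closedBall.mem_iff.1 h2
    refine ⟨ρ, hρ0, fun z hz => ?_⟩
    obtain ⟨x, ⟨hx1, hx2⟩, rfl⟩ := hρ (mem_closedBall_zero_iff.2 hz)
    rw [hHψ x hx1, hf0 _ hx2]
  have hG0 : G 0 = 0 := by
    have h1 : HasGradientAt H 0 0 := by
      refine (hasGradientAt_const 0 (0 : ℝ)).congr_of_eventuallyEq ?_
      filter_upwards [Metric.closedBall_mem_nhds (0 : EuclideanSpace ℂ ι) hρ0] with z hz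
      exact hρ z (mem_closedBall_zero_iff.1 hz)
    exact (hG 0).unique h1
  -- asymptotic behaviour
  obtain ⟨δ, hδ0, hδ1, hδ2, hδ3, hδ4⟩ : ∃ δ, 0 < δ ∧ δ ≤ Real.pi * ε / 2 ∧ δ ≤ μ / 2 ∧
      δ ≤ 2 * Real.pi * (1 - ε) ∧ δ ≤ 2 * (Real.pi - μ) :=
    ⟨min (min (Real.pi * ε / 2) (μ / 2)) (min (2 * Real.pi * (1 - ε)) (2 * (Real.pi - μ))),
      lt_min (lt_min (by positivity) (by positivity))
        (lt_min (mul_pos (by positivity) (by linarith)) (by linarith)),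
      (min_le_left _ _).trans (min_le_left _ _), (min_le_left _ _).trans (min_le_right _ _),
      (min_le_right _ _).trans (min_le_left _ _), (min_le_right _ _).trans (min_le_right _ _)⟩
  have hBδ : ∀ (j : ℤ) z, δ * ‖z‖ ≤ ‖(2 * Real.pi * j : ℝ) • z - B z‖ := by
    intro j z
    refine mul_norm_le_norm_smul_sub_diagOp hδ0.le (fun i => ?_) z
    simp only [ha]
    split_ifs
    · have h := le_abs_two_pi_mul_sub (ε := ε) (δ := δ) (by nlinarith) hδ3 (j - 1)
      refine h.trans_eq ?_
      congr 1; push_cast; ring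
    · have h := le_abs_two_pi_mul_sub (ε := μ / Real.pi) (δ := δ)
        (by rw [mul_assoc, mul_div_cancel₀ _ hpi.ne']; linarith)
        (by rw [mul_assoc, mul_sub, mul_div_cancel₀ _ hpi.ne']; linarith) j
      rwa [mul_div_cancel₀ _ hpi.ne'] at h
  obtain ⟨C₁, hC₁⟩ := exists_lower_bound_quadFun ha0 (θ := ε / 4) (by positivity) w
  have hδi : δ + Real.pi ≤ (1 - ε / 4) * a i₀ := by
    simp only [ha, if_true]; nlinarith
  have hδj : ∀ j, δ ≤ (1 - ε / 4) * a j := fun j => by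
    have := mul_le_mul (show 3 / 4 ≤ 1 - ε / 4 by linarith) (haμ j) hμ0.le (by linarith)
    linarith
  have hlow : ∀ z, δ * ‖z‖ ^ 2 + Real.pi * ‖z i₀‖ ^ 2 - (C₁ + M - C) ≤ H z := by
    intro z
    have h1 := mul_norm_sq_add_le (δ := δ) (x := Real.pi) i₀
      (b := fun j => (1 - ε / 4) * a j) (fun j => hδj j) hδi z
    simp only [mul_assoc, ← Finset.mul_sum] at h1
    have h2 := hC₁ z
    have h3 := neg_abs_le (k z)
    have h4 := hkM z
    rw [hHeq]
    simp only [hp]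
    linarith
  obtain ⟨y, hyc, hy, hy01, hact⟩ := exists_periodic_orbit hL0 hHs.continuous hGL hG0
    (abs_taylor_le hL0.le hG hGL) hH0 hρ0 hρ i₀ hδ0 hlow hBδ
    (C := ‖B w‖ + M) (fun z => by
      rw [hGB]; exact (norm_add_le _ _).trans (add_le_add le_rfl (hkg z)))
  refine hact.not_ge ?_
  by_cases hmeet : ∃ t ∈ Icc (0 : ℝ) 1, ∃ ζ, ‖ζ‖ < 1 ∧ y t = ψ ζ
  · obtain ⟨t₀, ht₀, ζ, hζ, hyζ⟩ := hmeet
    have h1 := eq_zero_of_orbit_meets_ball hψ hψi hsymp hG hL0.le hGL hfd (fun s => (hf' s).1)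
      (fun s => (hf' s).2.trans_lt hcπ) (fun z hz => hHψ z hz.le) hyc hy hy01 ht₀ hζ hyζ
    rw [← neg_nonneg, ← intervalIntegral.integral_neg]
    refine intervalIntegral.integral_nonneg zero_le_one fun t ht => ?_
    rw [h1 t ht, inner_zero_left]
    linarith [hH0 (y t)]
  · push Not at hmeet
    have hby : ∀ t ∈ Icc (0 : ℝ) 1, y t ∉ ψ '' Metric.closedBall 0 √(max s₁ 0) := by
      rintro t ht ⟨ζ, hζ, hyζ⟩
      exact hmeet t ht ζ ((mem_closedBall_zero_iff.1 hζ).trans_lt hρ1) hyζ.symm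
    refine action_nonpos_of_radial ha0 hGc (fun s hs => (hFF s hs).2) hyc hy hy01 hHs.continuous
      (a := a) (w := w) (fun t ht => ?_) (fun t ht => ?_)
    · have h1 : HasGradientAt H (F' (p (y t)) • (2 : ℝ) • diagOp a (y t + w)) (y t) := by
        have h2 := (hFd (p (y t))).comp_hasFDerivAt (y t) (hpG (y t)).hasFDerivAt
        rw [hasGradientAt_iff_hasFDerivAt, map_smul, ← hB2]
        refine HasFDerivAt.congr_of_eventuallyEq h2 ?_
        filter_upwards [hZ.isClosed.isOpen_compl.mem_nhds (hby t ht)] with z hz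
        simp only [hHdef, Function.comp_apply]
        rw [hb0 z hz, sub_zero]
      exact (hG _).unique h1
    · simp only [hHdef]
      rw [hb0 _ (hby t ht), sub_zero]

end Nonsqueezing

section Flow
open Set MeasureTheory Filter Topology

lemma isOpen_univ_prod_Ioo {X : Type*} [TopologicalSpace X] (a b : ℝ) :
    IsOpen ((univ : Set X) ×ˢ Ioo a b) := isOpen_univ.prod isOpen_Ioo

lemma hasFDerivAt_prodMk_const {X : Type*} [NormedAddCommGroup X] [NormedSpace ℝ X] (z : X)
    (s : ℝ) : HasFDerivAt (fun z : X => (z, s)) (ContinuousLinearMap.inl ℝ X ℝ) z :=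
  (hasFDerivAt_id z).prodMk (hasFDerivAt_const s z)

lemma hasDerivAt_const_prodMk {X : Type*} [NormedAddCommGroup X] [NormedSpace ℝ X] (z : X)
    (s : ℝ) : HasDerivAt (fun s : ℝ => (z, s)) ((0 : X), (1 : ℝ)) s :=
  (hasDerivAt_const s z).prodMk (hasDerivAt_id s)

variable {V : Type*} [NormedAddCommGroup V] [InnerProductSpace ℝ V] [CompleteSpace V]

lemma inner_fderiv_gradient_comm {k : V → ℝ} (hk : ContDiff ℝ ∞ k) (q u v : V) :
    ⟪fderiv ℝ (gradient k) q u, v⟫ = ⟪u, fderiv ℝ (gradient k) q v⟫ := by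
  have h1 : ∀ u v, ⟪fderiv ℝ (gradient k) q u, v⟫ = fderiv ℝ (fderiv ℝ k) q u v := by
    intro u v
    have h2 : HasFDerivAt (fderiv ℝ k) (fderiv ℝ (fderiv ℝ k) q) q :=
      ((hk.fderiv_right (m := ∞) (by simp)).differentiable (by simp) q).hasFDerivAt
    have h3 : HasFDerivAt (gradient k) _ q :=
      ((InnerProductSpace.toDual ℝ V).symm.toContinuousLinearEquiv.toContinuousLinearMap
        |>.hasFDerivAt).comp q h2
    rw [h3.fderiv]
    exact InnerProductSpace.toDual_symm_apply
  have h4 : IsSymmSndFDerivAt ℝ k q := (hk.contDiffAt (x := q)).isSymmSndFDerivAt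
      (by rw [minSmoothness_of_isRCLikeNormedField]; exact WithTop.coe_le_coe.2 (le_top (a := (2 : ℕ∞))))
  rw [h1, real_inner_comm, h1]
  exact h4 u v

variable {ι : Type*} [Fintype ι] {a b : ℝ} {Ψ : EuclideanSpace ℂ ι × ℝ → EuclideanSpace ℂ ι}
  {K : EuclideanSpace ℂ ι × ℝ → ℝ}

lemma contDiff_slice {X Y : Type*} [NormedAddCommGroup X] [NormedSpace ℝ X]
    [NormedAddCommGroup Y] [NormedSpace ℝ Y] {f : X × ℝ → Y}
    (hf : ContDiffOn ℝ ∞ f (univ ×ˢ Ioo a b)) {s : ℝ} (hs : s ∈ Ioo a b) :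
    ContDiff ℝ ∞ fun z => f (z, s) := by
  rw [← contDiffOn_univ]
  exact hf.comp (contDiff_id.prodMk contDiff_const).contDiffOn fun z _ => ⟨mem_univ _, hs⟩

/-- Hamiltonian flows are symplectic. -/
lemma symplectic_flow (hΨ : ContDiffOn ℝ ∞ Ψ (univ ×ˢ Ioo a b))
    (hK : ContDiffOn ℝ ∞ K (univ ×ˢ Ioo a b)) (h0 : ∀ z, Ψ (z, 0) = z)
    (hd : ∀ z, ∀ s ∈ Ioo a b, HasDerivAt (fun t => Ψ (z, t))
      (Complex.I • gradient (fun q => K (q, s)) (Ψ (z, s))) s)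
    (ha : a < 0) (hb : 1 < b) (z u v : EuclideanSpace ℂ ι) :
    ⟪Complex.I • fderiv ℝ (fun z => Ψ (z, 1)) z u, fderiv ℝ (fun z => Ψ (z, 1)) z v⟫ =
      ⟪Complex.I • u, v⟫ := by
  have hU := isOpen_univ_prod_Ioo (X := EuclideanSpace ℂ ι) a b
  have hmem : ∀ z : EuclideanSpace ℂ ι, ∀ s ∈ Ioo a b,
      (univ : Set (EuclideanSpace ℂ ι)) ×ˢ Ioo a b ∈ 𝓝 (z, s) := fun z s hs =>
    hU.mem_nhds ⟨mem_univ _, hs⟩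
  have hc : ∀ z, ∀ s ∈ Ioo a b, ContDiffAt ℝ ∞ Ψ (z, s) := fun z s hs =>
    hΨ.contDiffAt (hmem z s hs)
  have hD : ∀ z, ∀ s ∈ Ioo a b, HasFDerivAt Ψ (fderiv ℝ Ψ (z, s)) (z, s) := fun z s hs =>
    ((hc z s hs).differentiableAt (by simp)).hasFDerivAt
  have hD2 : ∀ z, ∀ s ∈ Ioo a b,
      HasFDerivAt (fderiv ℝ Ψ) (fderiv ℝ (fderiv ℝ Ψ) (z, s)) (z, s) := fun z s hs =>
    (((hc z s hs).fderiv_right (m := ∞) (by simp)).differentiableAt (by simp)).hasFDerivAt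
  have hslice : ∀ z, ∀ s ∈ Ioo a b, ∀ u,
      fderiv ℝ (fun z => Ψ (z, s)) z u = fderiv ℝ Ψ (z, s) (u, 0) := fun z s hs u => by
    exact DFunLike.congr_fun ((hD z s hs).comp z (hasFDerivAt_prodMk_const z s)).fderiv u
  have htime : ∀ z, ∀ s ∈ Ioo a b,
      fderiv ℝ Ψ (z, s) (0, 1) = Complex.I • gradient (fun q => K (q, s)) (Ψ (z, s)) :=
    fun z s hs => ((hD z s hs).comp_hasDerivAt s (hasDerivAt_const_prodMk z s)).unique (hd z s hs)
  have hmix : ∀ s ∈ Ioo a b, ∀ u, fderiv ℝ (fderiv ℝ Ψ) (z, s) (0, 1) (u, 0) =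
      Complex.I • fderiv ℝ (gradient fun q => K (q, s)) (Ψ (z, s))
        (fderiv ℝ Ψ (z, s) (u, 0)) := by
    intro s hs u
    have hsym : IsSymmSndFDerivAt ℝ Ψ (z, s) := (hc z s hs).isSymmSndFDerivAt
      (by rw [minSmoothness_of_isRCLikeNormedField]; exact WithTop.coe_le_coe.2 (le_top (a := (2 : ℕ∞))))
    rw [hsym (0, 1) (u, 0)]
    have h1 : HasFDerivAt (fun z => fderiv ℝ Ψ (z, s) (0, 1)) _ z :=
      ((hD2 z s hs).comp z (hasFDerivAt_prodMk_const z s)).clm_apply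
        (hasFDerivAt_const ((0 : EuclideanSpace ℂ ι), (1 : ℝ)) z)
    have hks := contDiff_slice hK hs
    have hgd : HasFDerivAt (gradient fun q => K (q, s))
        (fderiv ℝ (gradient fun q => K (q, s)) (Ψ (z, s))) (Ψ (z, s)) := by
      have : ContDiff ℝ ∞ (gradient fun q => K (q, s)) :=
        (InnerProductSpace.toDual ℝ
          (EuclideanSpace ℂ ι)).symm.toContinuousLinearEquiv.toContinuousLinearMap.contDiff.comp
            (hks.fderiv_right (m := ∞) (by simp))
      exact (this.differentiable (by simp) _).hasFDerivAt
    have h2 := (hgd.comp z ((hD z s hs).comp z (hasFDerivAt_prodMk_const z s))).const_smul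
      Complex.I
    have h3 : (fun z => fderiv ℝ Ψ (z, s) (0, 1)) =
        fun z => Complex.I • gradient (fun q => K (q, s)) (Ψ (z, s)) :=
      funext fun z => htime z s hs
    rw [h3] at h1
    have h4 := DFunLike.congr_fun (h1.unique h2) u
    simpa using h4
  have hdA : ∀ s ∈ Ioo a b, ∀ u, HasDerivAt (fun s => fderiv ℝ Ψ (z, s) (u, 0))
      (Complex.I • fderiv ℝ (gradient fun q => K (q, s)) (Ψ (z, s))
        (fderiv ℝ Ψ (z, s) (u, 0))) s := by
    intro s hs u
    rw [← hmix s hs]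
    have := ((hD2 z s hs).comp_hasDerivAt s (hasDerivAt_const_prodMk z s)).clm_apply
      (hasDerivAt_const s ((u : EuclideanSpace ℂ ι), (0 : ℝ)))
    simpa using this
  have hdI : ∀ {x : ℝ → EuclideanSpace ℂ ι} {x'} {s : ℝ}, HasDerivAt x x' s →
      HasDerivAt (fun s => Complex.I • x s) (Complex.I • x') s := fun h => h.const_smul Complex.I
  have hconst : ∀ s ∈ Ioo a b, HasDerivAt
      (fun s => ⟪Complex.I • fderiv ℝ Ψ (z, s) (u, 0), fderiv ℝ Ψ (z, s) (v, 0)⟫) 0 s := by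
    intro s hs
    refine ((hdI (hdA s hs u)).inner ℝ (hdA s hs v)).congr_deriv ?_
    rw [inner_I_smul_I_smul, smul_smul, Complex.I_mul_I, neg_one_smul, inner_neg_left,
      inner_fderiv_gradient_comm (contDiff_slice hK hs)]
    ring
  have h0I : (0 : ℝ) ∈ Ioo a b := ⟨ha, by linarith⟩
  have h1I : (1 : ℝ) ∈ Ioo a b := ⟨by linarith, hb⟩
  have heq := (convex_Ioo a b).is_const_of_fderivWithin_eq_zero (𝕜 := ℝ)
    (f := fun s => ⟪Complex.I • fderiv ℝ Ψ (z, s) (u, 0), fderiv ℝ Ψ (z, s) (v, 0)⟫)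
    (fun s hs => (hconst s hs).differentiableAt.differentiableWithinAt)
    (fun s hs => by
      rw [fderivWithin_of_isOpen isOpen_Ioo hs]
      ext; simp [(hconst s hs).deriv]) h1I h0I
  rw [hslice z 1 h1I, hslice z 1 h1I, heq, ← hslice z 0 h0I, ← hslice z 0 h0I]
  have : (fun z => Ψ (z, 0)) = id := funext h0
  rw [this, fderiv_id]
  rfl

/-- The time-one map of a Hamiltonian flow is injective. -/
lemma injective_flow (hK : ContDiffOn ℝ ∞ K (univ ×ˢ Ioo a b)) (h0 : ∀ z, Ψ (z, 0) = z)
    (hd : ∀ z, ∀ s ∈ Ioo a b, HasDerivAt (fun t => Ψ (z, t))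
      (Complex.I • gradient (fun q => K (q, s)) (Ψ (z, s))) s)
    (ha : a < 0) (hb : 1 < b) : Function.Injective fun z => Ψ (z, 1) := by
  intro z z' hz
  have hsub : Icc (0 : ℝ) 1 ⊆ Ioo a b := fun t ht => ⟨ha.trans_le ht.1, ht.2.trans_lt hb⟩
  have hcont : ∀ z, ContinuousOn (fun t => Ψ (z, t)) (Icc 0 1) := fun z t ht =>
    (hd z t (hsub ht)).continuousAt.continuousWithinAt
  have hbd : ∀ z, ∃ R, ∀ t ∈ Icc (0 : ℝ) 1, ‖Ψ (z, t)‖ ≤ R := fun z =>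
    isCompact_Icc.exists_bound_of_continuousOn (hcont z)
  obtain ⟨R₁, hR₁⟩ := hbd z
  obtain ⟨R₂, hR₂⟩ := hbd z'
  set S := Metric.closedBall (0 : EuclideanSpace ℂ ι) (max R₁ R₂) with hS
  have hfd : ContDiffOn ℝ ∞ (fderiv ℝ K) (univ ×ˢ Ioo a b) :=
    hK.fderiv_of_isOpen (isOpen_univ_prod_Ioo a b) (by simp)
  let pull : (EuclideanSpace ℂ ι × ℝ →L[ℝ] ℝ) →L[ℝ] (EuclideanSpace ℂ ι →L[ℝ] ℝ) :=
    (ContinuousLinearMap.compL ℝ _ _ ℝ).flip (ContinuousLinearMap.inl ℝ (EuclideanSpace ℂ ι) ℝ)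
  have hpull : ContDiffOn ℝ ∞ (fun p => pull (fderiv ℝ K p))
      ((univ : Set (EuclideanSpace ℂ ι)) ×ˢ Ioo a b) := pull.contDiff.comp_contDiffOn hfd
  obtain ⟨C, hC⟩ := (hpull.mono (prod_mono (subset_univ S) hsub)).exists_lipschitzOnWith
    (by simp) ((convex_closedBall _ _).prod (convex_Icc _ _))
    ((isCompact_closedBall _ _).prod isCompact_Icc)
  have hslice : ∀ s ∈ Icc (0 : ℝ) 1, ∀ q,
      fderiv ℝ (fun q => K (q, s)) q = pull (fderiv ℝ K (q, s)) := fun s hs q => by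
    have h1 : HasFDerivAt K (fderiv ℝ K (q, s)) (q, s) :=
      ((hK.contDiffAt ((isOpen_univ_prod_Ioo a b).mem_nhds
        ⟨mem_univ _, hsub hs⟩)).differentiableAt (by simp)).hasFDerivAt
    exact (h1.comp q (hasFDerivAt_prodMk_const q s)).fderiv
  have hlip : ∀ s ∈ Icc (0 : ℝ) 1,
      LipschitzOnWith C (fun q => Complex.I • gradient (fun q => K (q, s)) q) S := by
    intro s hs
    refine LipschitzOnWith.of_dist_le_mul fun q hq q' hq' => ?_
    have h1 := hC.dist_le_mul (q, s) ⟨hq, hs⟩ (q', s) ⟨hq', hs⟩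
    simp only [← hslice s hs] at h1
    rw [dist_eq_norm, ← smul_sub, norm_smul, Complex.norm_I, one_mul, gradient_sub_eq,
      ← dist_eq_norm]
    refine h1.trans_eq ?_
    rw [Prod.dist_eq]; simp
  have heq := ODE_solution_unique_of_mem_Icc_left (a := 0) (b := 1) (K := C)
    (v := fun s q => Complex.I • gradient (fun q => K (q, s)) q) (s := fun _ => S)
    (f := fun t => Ψ (z, t)) (g := fun t => Ψ (z', t))
    (fun t ht => hlip t (Ioc_subset_Icc_self ht)) (hcont z)
    (fun t ht => (hd z t (hsub (Ioc_subset_Icc_self ht))).hasDerivWithinAt)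
    (fun t ht => mem_closedBall_zero_iff.2
      ((hR₁ t (Ioc_subset_Icc_self ht)).trans (le_max_left _ _))) (hcont z')
    (fun t ht => (hd z' t (hsub (Ioc_subset_Icc_self ht))).hasDerivWithinAt)
    (fun t ht => mem_closedBall_zero_iff.2
      ((hR₂ t (Ioc_subset_Icc_self ht)).trans (le_max_right _ _))) hz
  have := heq (show (0 : ℝ) ∈ Icc 0 1 by simp)
  simpa [h0] using this

/-- Nonsqueezing for Hamiltonian flows on `ℂⁿ`. -/
theorem nonsqueezing_flow [DecidableEq ι] (i₀ : ι) (hΨ : ContDiffOn ℝ ∞ Ψ (univ ×ˢ Ioo a b))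
    (hK : ContDiffOn ℝ ∞ K (univ ×ˢ Ioo a b)) (h0 : ∀ z, Ψ (z, 0) = z)
    (hd : ∀ z, ∀ s ∈ Ioo a b, HasDerivAt (fun t => Ψ (z, t))
      (Complex.I • gradient (fun q => K (q, s)) (Ψ (z, s))) s)
    (ha : a < 0) (hb : 1 < b) {r : ℝ} (hr0 : 0 < r) (hr1 : r < 1)
    (hr : ∀ z, ‖z‖ ≤ 1 → ‖Ψ (z, 1) i₀‖ ≤ r) : False := by
  have hs := contDiff_slice hΨ (s := 1) ⟨by linarith, hb⟩
  refine nonsqueezing_of_symplectic i₀ (ψ := fun z => Ψ (z, 1) - Ψ (0, 1)) (w₀ := Ψ (0, 1) i₀)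
    (hs.sub contDiff_const) (fun z z' h => ?_) (sub_self _) (fun z u v => ?_) hr0 hr1
    (fun z hz => ?_)
  · exact injective_flow hK h0 hd ha hb (sub_left_injective h)
  · rw [fderiv_sub_const]
    exact symplectic_flow hΨ hK h0 hd ha hb z u v
  · simpa using hr z hz

end Flow

section Phase
open Set MeasureTheory Filter Topology

variable {n : ℕ}

/-- The identification `(x, ξ) ↦ x - iξ` of phase space with `ℂⁿ`. -/
def complexEquiv (n : ℕ) : Esp n ≃L[ℝ] EuclideanSpace ℂ (Fin n) :=
  LinearEquiv.toContinuousLinearEquiv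
    { toFun := fun p => WithLp.toLp 2 fun j => (⟨p.1 j, -p.2 j⟩ : ℂ)
      map_add' := fun p q => by ext j; apply Complex.ext <;> simp [add_comm]
      map_smul' := fun c p => by ext j; apply Complex.ext <;> simp
      invFun := fun z => (WithLp.toLp 2 fun j => (z j).re, WithLp.toLp 2 fun j => -(z j).im)
      left_inv := fun p => by ext j <;> simp
      right_inv := fun z => by ext j; apply Complex.ext <;> simp }

lemma complexEquiv_apply (p : Esp n) (j : Fin n) : complexEquiv n p j = ⟨p.1 j, -p.2 j⟩ := rfl

lemma inner_complexEquiv (p q : Esp n) :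
    ⟪complexEquiv n p, complexEquiv n q⟫ = ⟪p.1, q.1⟫ + ⟪p.2, q.2⟫ := by
  simp only [PiLp.inner_apply, complexEquiv_apply, Complex.inner, ← Finset.sum_add_distrib]
  refine Finset.sum_congr rfl fun j _ => ?_
  simp [Complex.mul_re]

lemma norm_sq_complexEquiv (p : Esp n) : ‖complexEquiv n p‖ ^ 2 = ‖p.1‖ ^ 2 + ‖p.2‖ ^ 2 := by
  rw [← real_inner_self_eq_norm_sq, inner_complexEquiv, real_inner_self_eq_norm_sq,
    real_inner_self_eq_norm_sq]

lemma I_smul_complexEquiv (p : Esp n) :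
    Complex.I • complexEquiv n p = complexEquiv n (p.2, -p.1) := by
  ext j
  apply Complex.ext <;> simp [complexEquiv_apply]

/-- In the complex coordinate `x - iξ` the Hamiltonian vector field is `i` times the gradient. -/
lemma complexEquiv_hamVF {h : Esp n → ℝ} (p : Esp n) (hh : DifferentiableAt ℝ h p) :
    complexEquiv n (hamVF h p) =
      Complex.I • gradient (fun z => h ((complexEquiv n).symm z)) (complexEquiv n p) := by
  have h1 : ∀ v, ⟪gradient (fun z => h ((complexEquiv n).symm z)) (complexEquiv n p), v⟫ =
      fderiv ℝ h p ((complexEquiv n).symm v) := fun v => by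
    have h2 : HasFDerivAt h (fderiv ℝ h p) ((complexEquiv n).symm (complexEquiv n p)) := by
      rw [ContinuousLinearEquiv.symm_apply_apply]; exact hh.hasFDerivAt
    have h3 := h2.comp (complexEquiv n p) (complexEquiv n).symm.hasFDerivAt
    rw [gradient, InnerProductSpace.toDual_symm_apply]
    exact DFunLike.congr_fun h3.fderiv v
  have h4 : ∀ v, ⟪gradient (fun η => h (p.1, η)) p.2, v⟫ = fderiv ℝ h p (0, v) := fun v => by
    have h2 : HasFDerivAt (fun η => (p.1, η)) (ContinuousLinearMap.inr ℝ _ _) p.2 :=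
      (hasFDerivAt_const p.1 p.2).prodMk (hasFDerivAt_id p.2)
    have h3 := HasFDerivAt.comp p.2 (show HasFDerivAt h _ (p.1, p.2) from hh.hasFDerivAt) h2
    rw [gradient, InnerProductSpace.toDual_symm_apply]
    exact DFunLike.congr_fun h3.fderiv v
  have h5 : ∀ v, ⟪gradient (fun y => h (y, p.2)) p.1, v⟫ = fderiv ℝ h p (v, 0) := fun v => by
    have h2 : HasFDerivAt (fun y => (y, p.2)) (ContinuousLinearMap.inl ℝ _ _) p.1 :=
      (hasFDerivAt_id p.1).prodMk (hasFDerivAt_const p.2 p.1)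
    have h3 := HasFDerivAt.comp p.1 (show HasFDerivAt h _ (p.1, p.2) from hh.hasFDerivAt) h2
    rw [gradient, InnerProductSpace.toDual_symm_apply]
    exact DFunLike.congr_fun h3.fderiv v
  refine ext_inner_right ℝ fun v => ?_
  obtain ⟨q, rfl⟩ := (complexEquiv n).surjective v
  rw [inner_complexEquiv, inner_I_smul_left, I_smul_complexEquiv, h1,
    ContinuousLinearEquiv.symm_apply_apply, hamVF]
  simp only [inner_neg_left]
  rw [h4, h5]
  have : (q.2, -q.1) = (q.2, 0) - ((0 : EuclideanSpace ℝ (Fin n)), q.1) := by simp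
  rw [this, map_sub]
  ring

end Phase

/-- Gromov nonsqueezing.  For `0 < r < 1` there is no Hamiltonian isotopy
(defined on an open interval `I = (a,b)` containing `0` and `1`, generated by a smooth
time-dependent Hamiltonian) whose time-one map sends the closed unit ball
`{(x,ξ) : ‖x‖² + ‖ξ‖² ≤ 1}` into the cylinder `{(x,ξ) : x₁² + ξ₁² ≤ r²}`. -/
theorem stmt_1 (n : ℕ) (hn : 1 ≤ n) (r : ℝ) (hr0 : 0 < r) (hr1 : r < 1) :
    ¬ ∃ (a b : ℝ) (Φ : Esp n × ℝ → Esp n) (h : Esp n × ℝ → ℝ),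
        a < 0 ∧ 1 < b ∧
        ContDiffOn ℝ ∞ Φ (Set.univ ×ˢ Set.Ioo a b) ∧
        ContDiffOn ℝ ∞ h (Set.univ ×ˢ Set.Ioo a b) ∧
        (∀ p : Esp n, Φ (p, 0) = p) ∧
        (∀ (p : Esp n), ∀ s ∈ Set.Ioo a b,
          HasDerivAt (fun t => Φ (p, t)) (hamVF (fun q => h (q, s)) (Φ (p, s))) s) ∧
        (∀ p : Esp n, ‖p.1‖ ^ 2 + ‖p.2‖ ^ 2 ≤ 1 →
          (Φ (p, 1)).1 ⟨0, hn⟩ ^ 2 + (Φ (p, 1)).2 ⟨0, hn⟩ ^ 2 ≤ r ^ 2) := by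
  rintro ⟨a, b, Φ, h, ha, hb, hΦ, hh, h0, hd, hr⟩
  set T := complexEquiv n with hT
  have hS : ContDiff ℝ ∞ fun p : EuclideanSpace ℂ (Fin n) × ℝ => (T.symm p.1, p.2) :=
    (T.symm.contDiff.comp contDiff_fst).prodMk contDiff_snd
  have hmaps : Set.MapsTo (fun p : EuclideanSpace ℂ (Fin n) × ℝ => (T.symm p.1, p.2))
      (Set.univ ×ˢ Set.Ioo a b) (Set.univ ×ˢ Set.Ioo a b) := fun p hp => ⟨Set.mem_univ _, hp.2⟩
  refine nonsqueezing_flow (⟨0, hn⟩ : Fin n) (Ψ := fun p => T (Φ (T.symm p.1, p.2)))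
    (K := fun p => h (T.symm p.1, p.2)) (T.contDiff.comp_contDiffOn (hΦ.comp hS.contDiffOn hmaps))
    (hh.comp hS.contDiffOn hmaps) (fun z => ?_) (fun z s hs => ?_) ha hb hr0 hr1 (fun z hz => ?_)
  · simp [h0]
  · have h1 := T.hasFDerivAt.comp_hasDerivAt s (hd (T.symm z) s hs)
    refine h1.congr_deriv ?_
    exact complexEquiv_hamVF (h := fun q => h (q, s)) _
      ((contDiff_slice hh hs).differentiable (by simp) _)
  · have h1 := hr (T.symm z) (by
      rw [← norm_sq_complexEquiv, ← hT, ContinuousLinearEquiv.apply_symm_apply]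
      exact pow_le_one₀ (norm_nonneg _) hz)
    refine le_of_sq_le_sq ?_ hr0.le
    rw [hT, complexEquiv_apply, Complex.sq_norm, Complex.normSq_mk]
    refine le_trans (le_of_eq ?_) h1
    ring
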